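/- Suppose the tuning parameter satisfies λ/n ∈ [6σ₀²(|τ₀|+1)log(p/2)/n + t, 0.05·C_min] for a constant t > 0, that |τ₀|·log p / n < 0.23, and that C_min > 120·((|τ₀|+2)·log(p+1)/n)·σ₀². Then for any finite number d of repro samples, any Λ ⊆ {1,…,p}, and any level α ∈ (0,1), the coefficient confidence set satisfies ℙ(β_{0,Λ} ∈ Γ^{β_Λ}_α(Y)) ≥ α − [6·exp(−(n/(18σ₀²))·(0.3·C_min − 36·(log(p+1)/n)·σ₀²)) + 3·exp(−n·t/(3σ₀²)) + exp(−n·d·(0.23 − (|τ₀|·log p + 2)/n))]; in particular, there exists c₂ > 0 such that the deficit below α is o(e^{−c₂n}) as n → ∞. -/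

import Mathlib

open MeasureTheory ProbabilityTheory Matrix Filter
open scoped ENNReal Classical

noncomputable section

namespace ReproSamples

/-- Squared Euclidean norm of a vector in `ℝⁿ`. -/
def sqnorm {n : ℕ} (v : Fin n → ℝ) : ℝ := ∑ i, (v i) ^ 2

/-- The vector `β` with all coordinates outside `τ` set to `0`; this encodes the
vector `β_τ ∈ ℝ^{|τ|}`, so that `X_τ β_τ = X.mulVec (maskOn τ β)`. -/
def maskOn {p : ℕ} (τ : Finset (Fin p)) (β : Fin p → ℝ) : Fin p → ℝ :=
  fun j => if j ∈ τ then β j else 0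

/-- The submatrix `X_τ` of the columns of `X` indexed by `τ`. -/
def subcols {n p : ℕ} (X : Matrix (Fin n) (Fin p) ℝ) (τ : Finset (Fin p)) :
    Matrix (Fin n) {j // j ∈ τ} ℝ :=
  Matrix.of fun i j => X i j.1

/-- The matrix `M (MᵀM)⁻¹ Mᵀ` (orthogonal projection onto the column span of `M`
when `MᵀM` is invertible). -/
def projMat {n : ℕ} {m : Type} [Fintype m] [DecidableEq m]
    (M : Matrix (Fin n) m ℝ) : Matrix (Fin n) (Fin n) ℝ :=
  M * (Mᵀ * M)⁻¹ * Mᵀ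

/-- The projection matrix `H_τ = X_τ (X_τᵀ X_τ)⁻¹ X_τᵀ`. -/
def proj {n p : ℕ} (X : Matrix (Fin n) (Fin p) ℝ) (τ : Finset (Fin p)) :
    Matrix (Fin n) (Fin n) ℝ :=
  projMat (subcols X τ)

/-- Identifiability: `τ₀` is the unique minimizer of `|τ|` over
`{τ : X_τ β_τ = X_{τ₀} β₀ for some β_τ}` (here `β₀` is supported on `τ₀`). -/
def Identifiable {n p : ℕ} (X : Matrix (Fin n) (Fin p) ℝ) (τ₀ : Finset (Fin p))
    (β₀ : Fin p → ℝ) : Prop :=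
  ∀ τ : Finset (Fin p), (∃ β : Fin p → ℝ, X.mulVec (maskOn τ β) = X.mulVec β₀) →
    τ ≠ τ₀ → τ₀.card < τ.card

/-- The separation constant `C_min`. -/
def Cmin {n p : ℕ} (X : Matrix (Fin n) (Fin p) ℝ) (τ₀ : Finset (Fin p))
    (β₀ : Fin p → ℝ) : ℝ :=
  sInf ((fun τ : Finset (Fin p) =>
      sqnorm ((1 - proj X τ).mulVec (X.mulVec β₀)) /
        ((n * max (τ₀ \ τ).card 1 : ℕ) : ℝ)) ''
    {τ : Finset (Fin p) | τ ≠ τ₀ ∧ τ.card ≤ τ₀.card})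

/-- Penalized objective `min_{β_τ, σ} ‖y − X_τ β_τ − σ u*‖² + λ|τ|`. -/
def objPen {n p : ℕ} (X : Matrix (Fin n) (Fin p) ℝ) (lam : ℝ) (y ustar : Fin n → ℝ)
    (τ : Finset (Fin p)) : ℝ :=
  (⨅ bs : (Fin p → ℝ) × ℝ, sqnorm (y - X.mulVec (maskOn τ bs.1) - bs.2 • ustar)) +
    lam * τ.card

/-- Un-penalized objective `min_{β_τ, σ} ‖y − X_τ β_τ − σ u*‖²`. -/
def objFit {n p : ℕ} (X : Matrix (Fin n) (Fin p) ℝ) (y ustar : Fin n → ℝ)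
    (τ : Finset (Fin p)) : ℝ :=
  ⨅ bs : (Fin p → ℝ) × ℝ, sqnorm (y - X.mulVec (maskOn τ bs.1) - bs.2 • ustar)

/-- Standard Gaussian measure `N(0, I_n)` on `ℝⁿ`. -/
def stdGaussian (n : ℕ) : Measure (Fin n → ℝ) :=
  Measure.pi fun _ => gaussianReal 0 1

/-- Joint law of `(U, (U*_1, …, U*_d))`, all i.i.d. `N(0, I_n)`. -/
def jointMeasure (n d : ℕ) : Measure ((Fin n → ℝ) × (Fin d → Fin n → ℝ)) :=
  (stdGaussian n).prod (Measure.pi fun _ : Fin d => stdGaussian n)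

/-- Squared cosine of the angle between two vectors. -/
def rho {n : ℕ} (v w : Fin n → ℝ) : ℝ := (v ⬝ᵥ w) ^ 2 / (sqnorm v * sqnorm w)

/-- `ρ_{τ⊥}(v, w) = ρ((I−H_τ)v, (I−H_τ)w)`. -/
def rhoPerp {n p : ℕ} (X : Matrix (Fin n) (Fin p) ℝ) (τ : Finset (Fin p))
    (v w : Fin n → ℝ) : ℝ :=
  rho ((1 - proj X τ).mulVec v) ((1 - proj X τ).mulVec w)

/-- `ρ(v, τ) = ‖H_τ v‖²/‖v‖²`. -/
def rhoTau {n p : ℕ} (X : Matrix (Fin n) (Fin p) ℝ) (v : Fin n → ℝ)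
    (τ : Finset (Fin p)) : ℝ :=
  sqnorm ((proj X τ).mulVec v) / sqnorm v

/-- The augmented matrix `(X_τ, u)`. -/
def augcols {n p : ℕ} (X : Matrix (Fin n) (Fin p) ℝ) (τ : Finset (Fin p))
    (u : Fin n → ℝ) : Matrix (Fin n) ({j // j ∈ τ} ⊕ Unit) ℝ :=
  Matrix.of fun i j => Sum.elim (fun k : {j // j ∈ τ} => X i k.1) (fun _ => u i) j

/-- The projection matrix `H_{τ,u}` onto the column span of `(X_τ, u)`. -/
def projAug {n p : ℕ} (X : Matrix (Fin n) (Fin p) ℝ) (τ : Finset (Fin p))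
    (u : Fin n → ℝ) : Matrix (Fin n) (Fin n) ℝ :=
  projMat (augcols X τ u)

/-- `γ²_{(u, τ₀)} = 1 − min_{|τ| < |τ₀|} ‖(I−H_{τ,u})X_{τ₀}β₀‖²/‖(I−H_τ)X_{τ₀}β₀‖²`. -/
def gammaSq {n p : ℕ} (X : Matrix (Fin n) (Fin p) ℝ) (τ₀ : Finset (Fin p))
    (β₀ : Fin p → ℝ) (u : Fin n → ℝ) : ℝ :=
  1 - sInf ((fun τ : Finset (Fin p) =>
      sqnorm ((1 - projAug X τ u).mulVec (X.mulVec β₀)) /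
        sqnorm ((1 - proj X τ).mulVec (X.mulVec β₀))) ''
    {τ : Finset (Fin p) | τ.card < τ₀.card})

/-- Residual sum of squares `min_β ‖y − X_τ β‖²`. -/
def rss {n p : ℕ} (X : Matrix (Fin n) (Fin p) ℝ) (y : Fin n → ℝ)
    (τ : Finset (Fin p)) : ℝ :=
  ⨅ β : Fin p → ℝ, sqnorm (y - X.mulVec (maskOn τ β))

/-- `Y*_w = a + b (I−H_τ)u / ‖(I−H_τ)u‖`. -/
def ystar {n p : ℕ} (X : Matrix (Fin n) (Fin p) ℝ) (τ : Finset (Fin p))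
    (a : Fin n → ℝ) (b : ℝ) (u : Fin n → ℝ) : Fin n → ℝ :=
  a + (b / Real.sqrt (sqnorm ((1 - proj X τ).mulVec u))) • ((1 - proj X τ).mulVec u)

/-- `p_{(w,τ)}(τ') = ℙ(T̃(Y*_w, τ) = τ')`. -/
def pfun {n p : ℕ} (X : Matrix (Fin n) (Fin p) ℝ)
    (Tt : (Fin n → ℝ) → Finset (Fin p) → Finset (Fin p))
    (τ : Finset (Fin p)) (a : Fin n → ℝ) (b : ℝ) (τ' : Finset (Fin p)) : ℝ :=
  ((stdGaussian n) {u | Tt (ystar X τ a b u) τ = τ'}).toReal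

/-- `B_α(τ, w) = {τ* : ∑_{τ' : p(τ') ≤ p(τ*)} p(τ') ≥ 1 − α}`. -/
def Bset {n p : ℕ} (X : Matrix (Fin n) (Fin p) ℝ)
    (Tt : (Fin n → ℝ) → Finset (Fin p) → Finset (Fin p)) (α : ℝ)
    (τ : Finset (Fin p)) (a : Fin n → ℝ) (b : ℝ) : Set (Finset (Fin p)) :=
  {τstar | 1 - α ≤
    ∑ τ' ∈ Finset.univ.filter (fun τ' => pfun X Tt τ a b τ' ≤ pfun X Tt τ a b τstar),
      pfun X Tt τ a b τ'}

/-- `τ ∈ Γ̄^τ_α(y)`-membership test: `T̃(y,τ) ∈ B_α(τ, W̃(y,τ))` with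
`W̃(y,τ) = (H_τ y, ‖(I−H_τ)y‖)`. -/
def inCS {n p : ℕ} (X : Matrix (Fin n) (Fin p) ℝ)
    (Tt : (Fin n → ℝ) → Finset (Fin p) → Finset (Fin p)) (α : ℝ)
    (y : Fin n → ℝ) (τ : Finset (Fin p)) : Prop :=
  Tt y τ ∈ Bset X Tt α τ ((proj X τ).mulVec y)
    (Real.sqrt (sqnorm ((1 - proj X τ).mulVec y)))

/-- `O_{τ,Λ}`: orthogonal projection onto the column span of `(I−H_{τ∖Λ}) X_{Λ∩τ}`. -/
def projO {n p : ℕ} (X : Matrix (Fin n) (Fin p) ℝ) (τ Λ : Finset (Fin p)) :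
    Matrix (Fin n) (Fin n) ℝ :=
  projMat ((1 - proj X (τ \ Λ)) * subcols X (Λ ∩ τ))

/-- The nuclear mapping `T̃(y, (β_Λ, τ))` with values in `EReal` (it takes the value
`⊤ = +∞` when `β_i ≠ 0` for some `i ∈ Λ ∖ τ`). -/
def Tnuc {n p : ℕ} (X : Matrix (Fin n) (Fin p) ℝ) (Λ τ : Finset (Fin p))
    (β : Fin p → ℝ) (y : Fin n → ℝ) : EReal :=
  if ∃ i ∈ Λ \ τ, β i ≠ 0 then ⊤
  else if Λ ∩ τ = ∅ then 0
  else ((((y - X.mulVec (maskOn Λ β)) ⬝ᵥ (projO X τ Λ).mulVec (y - X.mulVec (maskOn Λ β))) /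
    (((y - X.mulVec (maskOn Λ β)) ⬝ᵥ (1 - proj X τ).mulVec (y - X.mulVec (maskOn Λ β))) /
      ((n : ℝ) - τ.card)) : ℝ) : EReal)

/-- The statistic `u ↦ (uᵀ O_{τ,Λ} u)/(uᵀ(I−H_τ)u/(n−|τ|))`. -/
def fstat {n p : ℕ} (X : Matrix (Fin n) (Fin p) ℝ) (τ Λ : Finset (Fin p))
    (u : Fin n → ℝ) : ℝ :=
  (u ⬝ᵥ (projO X τ Λ).mulVec u) / ((u ⬝ᵥ (1 - proj X τ).mulVec u) / ((n : ℝ) - τ.card))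

/-- The `α`-quantile `q_α(τ, Λ)` of the law of `fstat` under `N(0, I_n)`. -/
def qant {n p : ℕ} (X : Matrix (Fin n) (Fin p) ℝ) (τ Λ : Finset (Fin p)) (α : ℝ) : ℝ :=
  sInf {x : ℝ | α ≤ (((stdGaussian n).map (fstat X τ Λ)) (Set.Iic x)).toReal}


section


lemma gauss1 (h c : ℝ) (hh : h < 1/2) :
    ∫⁻ x, ENNReal.ofReal (Real.exp (h * x ^ 2 + c * x)) ∂(gaussianReal 0 1) =
      ENNReal.ofReal (1 / Real.sqrt (1 - 2 * h) * Real.exp (c ^ 2 / (2 * (1 - 2 * h)))) := by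
  have hpos : 0 < 1 - 2 * h := by linarith
  rw [gaussianReal_of_var_ne_zero _ one_ne_zero,
    lintegral_withDensity_eq_lintegral_mul _ (measurable_gaussianPDF _ _) (by fun_prop)]
  set v : NNReal := ⟨1 / (1 - 2 * h), by positivity⟩ with hv
  have hv0 : v ≠ 0 := by
    intro h0
    have h3 : (v : ℝ) = 0 := by rw [h0]; rfl
    have h4 : 0 < 1 / (1 - 2 * h) := by positivity
    exact h4.ne' h3
  have hvr : (v : ℝ) = 1 / (1 - 2 * h) := rfl
  have key : ∀ x, (gaussianPDF 0 1 * fun x => ENNReal.ofReal (Real.exp (h * x ^ 2 + c * x))) x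
      = ENNReal.ofReal (1 / Real.sqrt (1 - 2 * h) * Real.exp (c ^ 2 / (2 * (1 - 2 * h)))) *
        gaussianPDF (c / (1 - 2 * h)) v x := by
    intro x
    simp only [Pi.mul_apply, gaussianPDF]
    rw [← ENNReal.ofReal_mul (gaussianPDFReal_nonneg _ _ _), ← ENNReal.ofReal_mul (by positivity)]
    congr 1
    simp only [gaussianPDFReal, hvr, NNReal.coe_one]
    have e1 : Real.sqrt (2 * Real.pi * (1 / (1 - 2 * h))) =
        Real.sqrt (2 * Real.pi) / Real.sqrt (1 - 2 * h) := by
      rw [mul_one_div, Real.sqrt_div (by positivity)]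
    rw [e1, mul_one, mul_assoc, ← Real.exp_add]
    have hs : Real.sqrt (1 - 2 * h) ≠ 0 := (Real.sqrt_pos.2 hpos).ne'
    have hs2 : Real.sqrt (2 * Real.pi) ≠ 0 := by positivity
    have : 1 / Real.sqrt (1 - 2 * h) * Real.exp (c ^ 2 / (2 * (1 - 2 * h))) *
        ((Real.sqrt (2 * Real.pi) / Real.sqrt (1 - 2 * h))⁻¹ *
          Real.exp (-(x - c / (1 - 2 * h)) ^ 2 / (2 * (1 / (1 - 2 * h))))) =
        (Real.sqrt (2 * Real.pi))⁻¹ * Real.exp (c ^ 2 / (2 * (1 - 2 * h)) +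
          (-(x - c / (1 - 2 * h)) ^ 2 / (2 * (1 / (1 - 2 * h))))) := by
      rw [Real.exp_add]
      field_simp
    rw [this]
    congr 2
    field_simp
    ring
  simp_rw [key]
  rw [lintegral_const_mul _ (measurable_gaussianPDF _ _), lintegral_gaussianPDF_eq_one _ hv0, mul_one]

abbrev EE (n : ℕ) := EuclideanSpace ℝ (Fin n)
abbrev tl {n : ℕ} (u : Fin n → ℝ) : EE n := WithLp.toLp 2 u

lemma measurable_tl {n : ℕ} : Measurable (tl : (Fin n → ℝ) → EE n) := by
  unfold tl; fun_prop

lemma family_law {n : ℕ} {ι : Type} [Fintype ι] (v : ι → EE n) (hv : Orthonormal ℝ v) :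
    (stdGaussian n).map (fun u i => inner ℝ (v i) (tl u)) =
      Measure.pi (fun _ : ι => gaussianReal 0 1) := by
  have hinj : MeasurableEmbedding (WithLp.toLp 2 : (ι → ℝ) → EuclideanSpace ℝ ι) :=
    (MeasurableEquiv.toLp 2 (ι → ℝ)).measurableEmbedding
  have hm : Measurable (fun (u : Fin n → ℝ) i => (inner ℝ (v i) (tl u) : ℝ)) := by
    apply measurable_pi_lambda
    intro i
    have := measurable_tl (n := n)
    fun_prop
  have h2 : ((stdGaussian n).map (fun u i => (inner ℝ (v i) (tl u) : ℝ))).map (WithLp.toLp 2)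
      = (Measure.pi (fun _ : ι => gaussianReal 0 1)).map (WithLp.toLp 2) := by
    rw [map_pi_eq_stdGaussian]
    have e : ((stdGaussian n).map (fun u i => (inner ℝ (v i) (tl u) : ℝ))).map (WithLp.toLp 2)
       = (ProbabilityTheory.stdGaussian (EE n)).map
         (fun x => (WithLp.toLp 2 (fun i => (inner ℝ (v i) x : ℝ)) : EuclideanSpace ℝ ι)) := by
      rw [← map_pi_eq_stdGaussian, Measure.map_map hinj.measurable hm,
        Measure.map_map (by fun_prop) (by fun_prop)]
      rfl
    rw [e]
    apply Measure.ext_of_charFun (E := EuclideanSpace ℝ ι)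
    ext t
    rw [charFun_stdGaussian, charFun_apply, integral_map (by fun_prop) (by fun_prop)]
    have : ∀ x : EE n, (inner ℝ (WithLp.toLp 2 (fun i => (inner ℝ (v i) x : ℝ)) : EuclideanSpace ℝ ι) t : ℝ)
        = inner ℝ x (∑ i, t i • v i) := by
      intro x
      rw [inner_sum, PiLp.inner_apply]
      apply Finset.sum_congr rfl
      intro i _
      rw [real_inner_smul_right, real_inner_comm]
      simp [real_inner_comm, mul_comm]
    simp_rw [this]
    rw [← charFun_apply, charFun_stdGaussian]
    congr 3
    have : ‖∑ i, t i • v i‖ ^ 2 = ‖t‖ ^ 2 := by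
      rw [← real_inner_self_eq_norm_sq, hv.inner_sum, EuclideanSpace.real_norm_sq_eq]
      simp [sq]
    exact_mod_cast this
  have h3 := congrArg (Measure.comap (WithLp.toLp 2)) h2
  rwa [hinj.comap_map, hinj.comap_map] at h3

lemma pi_prod_lintegral {ι : Type} [Fintype ι] (f : ι → ℝ → ℝ≥0∞) (hf : ∀ i, Measurable (f i)) :
    ∫⁻ x, ∏ i, f i (x i) ∂(Measure.pi (fun _ : ι => gaussianReal 0 1)) =
      ∏ i, ∫⁻ x, f i x ∂(gaussianReal 0 1) := by
  have hi : iIndepFun (fun i (x : ι → ℝ) => f i (x i)) (Measure.pi (fun _ : ι => gaussianReal 0 1)) :=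
    iIndepFun_pi (X := fun i => f i) (fun i => (hf i).aemeasurable)
  rw [lintegral_prod_eq_prod_lintegral_of_indepFun Finset.univ _ hi
    (fun i => (hf i).comp (measurable_pi_apply i))]
  apply Finset.prod_congr rfl
  intro i _
  exact (measurePreserving_eval (fun _ : ι => gaussianReal 0 1) i).lintegral_comp (hf i)

lemma mgf_family {n : ℕ} {ι : Type} [Fintype ι] (v : ι → EE n) (hv : Orthonormal ℝ v)
    (h c : ι → ℝ) (hh : ∀ i, h i < 1/2) :
    ∫⁻ u, ENNReal.ofReal (Real.exp (∑ i, (h i * (inner ℝ (v i) (tl u)) ^ 2 +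
        c i * inner ℝ (v i) (tl u)))) ∂(stdGaussian n) =
      ENNReal.ofReal (∏ i, (1 / Real.sqrt (1 - 2 * h i) *
        Real.exp (c i ^ 2 / (2 * (1 - 2 * h i))))) := by
  have hm : Measurable (fun (u : Fin n → ℝ) i => (inner ℝ (v i) (tl u) : ℝ)) := by
    apply measurable_pi_lambda
    intro i
    have := measurable_tl (n := n)
    fun_prop
  have h1 := lintegral_map (μ := stdGaussian n)
    (f := fun x : ι → ℝ => ENNReal.ofReal (Real.exp (∑ i, (h i * (x i) ^ 2 + c i * x i))))
    (by fun_prop) hm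
  rw [← h1, family_law v hv]
  simp_rw [Real.exp_sum]
  rw [ENNReal.ofReal_prod_of_nonneg (fun i _ => by positivity)]
  simp_rw [ENNReal.ofReal_prod_of_nonneg (fun i _ => (Real.exp_pos _).le)]
  rw [pi_prod_lintegral (fun i x => ENNReal.ofReal (Real.exp (h i * x ^ 2 + c i * x)))
    (fun i => by fun_prop)]
  simp_rw [gauss1 _ _ (hh _)]

lemma normsq_proj {n : ℕ} (W : Submodule ℝ (EE n)) (x : EE n) :
    ‖W.starProjection x‖ ^ 2 =
      ∑ i, (inner ℝ ((stdOrthonormalBasis ℝ W i : W) : EE n) x) ^ 2 := by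
  have := (stdOrthonormalBasis ℝ W).sum_sq_norm_inner_right (W.orthogonalProjectionOnto x)
  rw [Submodule.starProjection_apply, ← Submodule.coe_norm, ← this]
  apply Finset.sum_congr rfl
  intro i _
  rw [Real.norm_eq_abs, sq_abs, Submodule.coe_inner, ← Submodule.starProjection_apply]
  congr 1
  rw [← Submodule.inner_starProjection_left_eq_right]
  simp


end

section


lemma markov_exp {n : ℕ} (A : Set (Fin n → ℝ)) (f : (Fin n → ℝ) → ℝ) (hf : Measurable f)
    (hA : ∀ u ∈ A, 0 ≤ f u)
    : stdGaussian n A ≤ ∫⁻ u, ENNReal.ofReal (Real.exp (f u)) ∂(stdGaussian n) := by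
  calc stdGaussian n A ≤ stdGaussian n {u | 1 ≤ ENNReal.ofReal (Real.exp (f u))} := by
        apply measure_mono
        intro u hu
        simp only [Set.mem_ofPred_eq]
        rw [← ENNReal.ofReal_one]
        exact ENNReal.ofReal_le_ofReal (Real.one_le_exp (hA u hu))
    _ ≤ _ := by
        have := mul_meas_ge_le_lintegral (μ := stdGaussian n)
          (f := fun u => ENNReal.ofReal (Real.exp (f u))) (by fun_prop) 1
        simpa using this

lemma inner_proj {n : ℕ} (W : Submodule ℝ (EE n)) (x y : EE n) :
    inner ℝ (W.starProjection x) y =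
      ∑ i, (inner ℝ ((stdOrthonormalBasis ℝ W i : W) : EE n) x) *
        (inner ℝ ((stdOrthonormalBasis ℝ W i : W) : EE n) y) := by
  have := (stdOrthonormalBasis ℝ W).sum_inner_mul_inner (W.orthogonalProjectionOnto x)
    (W.orthogonalProjectionOnto y)
  have e : ∀ (i) (z : EE n), inner ℝ ((stdOrthonormalBasis ℝ W i : W)) (W.orthogonalProjectionOnto z) =
      inner ℝ ((stdOrthonormalBasis ℝ W i : W) : EE n) z := by
    intro i z
    rw [Submodule.coe_inner, ← Submodule.starProjection_apply,
      ← Submodule.inner_starProjection_left_eq_right]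
    simp
  have h2 : inner ℝ (W.starProjection x) y =
      inner ℝ (W.orthogonalProjectionOnto x) (W.orthogonalProjectionOnto y) := by
    rw [Submodule.coe_inner, ← Submodule.starProjection_apply, ← Submodule.starProjection_apply]
    have h3 := W.inner_starProjection_left_eq_right (W.starProjection x) y
    rw [← h3, W.starProjection_eq_self_iff.2 (W.starProjection_apply_mem x)]
  rw [h2, ← this]
  apply Finset.sum_congr rfl
  intro i _
  rw [real_inner_comm, e, e]

lemma mgf2 {n : ℕ} (A B : Submodule ℝ (EE n)) (hAB : A ⟂ B) (h₁ h₂ : ℝ) (hh₁ : h₁ < 1/2)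
    (hh₂ : h₂ < 1/2) (bv : EE n) :
    ∫⁻ u, ENNReal.ofReal (Real.exp (
        (h₁ * ‖A.starProjection (tl u)‖ ^ 2 + inner ℝ (A.starProjection bv) (tl u)) +
        (h₂ * ‖B.starProjection (tl u)‖ ^ 2 + inner ℝ (B.starProjection bv) (tl u)))) ∂(stdGaussian n) =
      ENNReal.ofReal (
        ((1 / Real.sqrt (1 - 2 * h₁)) ^ (Module.finrank ℝ A) *
          Real.exp (‖A.starProjection bv‖ ^ 2 / (2 * (1 - 2 * h₁)))) *
        ((1 / Real.sqrt (1 - 2 * h₂)) ^ (Module.finrank ℝ B) *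
          Real.exp (‖B.starProjection bv‖ ^ 2 / (2 * (1 - 2 * h₂))))) := by
  set v : Fin (Module.finrank ℝ A) ⊕ Fin (Module.finrank ℝ B) → EE n :=
    Sum.elim (fun i => ((stdOrthonormalBasis ℝ A i : A) : EE n))
      (fun i => ((stdOrthonormalBasis ℝ B i : B) : EE n)) with hvdef
  have hA := (stdOrthonormalBasis ℝ A).orthonormal
  have hB := (stdOrthonormalBasis ℝ B).orthonormal
  have hv : Orthonormal ℝ v := by
    constructor
    · rintro (i | i)
      · exact hA.1 i
      · exact hB.1 i
    · rintro (i | i) (j | j) hij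
      · exact hA.2 (fun h => hij (by rw [h]))
      · exact Submodule.isOrtho_iff_inner_eq.1 hAB _ (Subtype.mem _) _ (Subtype.mem _)
      · exact Submodule.isOrtho_iff_inner_eq.1 hAB.symm _ (Subtype.mem _) _ (Subtype.mem _)
      · exact hB.2 (fun h => hij (by rw [h]))
  have := mgf_family v hv (Sum.elim (fun _ => h₁) (fun _ => h₂)) (fun i => inner ℝ (v i) bv)
    (by rintro (i | i) <;> assumption)
  simp only [Fintype.sum_sum_type, Fintype.prod_sum_type, Sum.elim_inl, Sum.elim_inr, hvdef] at this
  simp only [Finset.sum_add_distrib, ← Finset.mul_sum, ← normsq_proj, ← inner_proj] at this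
  rw [this]
  simp only [Finset.prod_mul_distrib, Finset.prod_const, ← Real.exp_sum, ← Finset.sum_div,
    ← normsq_proj, Finset.card_univ, Fintype.card_fin]

lemma one_div_sqrt_pow_le {h : ℝ} (h0 : 0 ≤ h) (hh : h < 1/2) {a m : ℕ} (ham : a ≤ m) :
    (1 / Real.sqrt (1 - 2 * h)) ^ a ≤ (1 / Real.sqrt (1 - 2 * h)) ^ m := by
  apply pow_le_pow_right₀ _ ham
  rw [le_div_iff₀ (Real.sqrt_pos.2 (by linarith)), one_mul]
  exact Real.sqrt_le_one.2 (by linarith)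

lemma chern1 {n : ℕ} (W : Submodule ℝ (EE n)) (h : ℝ) (h0 : 0 ≤ h) (hh : h < 1/2)
    (bv : EE n) (m : ℕ) (hm : Module.finrank ℝ W ≤ m) (a : ℝ) (S : Set (Fin n → ℝ))
    (hS : ∀ u ∈ S, a ≤ h * ‖W.starProjection (tl u)‖ ^ 2 + inner ℝ bv (tl u)) :
    stdGaussian n S ≤ ENNReal.ofReal ((1 / Real.sqrt (1 - 2 * h)) ^ m *
      Real.exp (‖bv‖ ^ 2 / (2 * (1 - 2 * h)) - a)) := by
  have hmt := measurable_tl (n := n)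
  refine (markov_exp S (fun u => (h * ‖W.starProjection (tl u)‖ ^ 2 + inner ℝ bv (tl u)) - a)
    (by fun_prop) (fun u hu => by linarith [hS u hu])).trans ?_
  have key := mgf2 W Wᗮ (Submodule.isOrtho_orthogonal_right W) h 0 hh (by norm_num) bv
  have e : ∀ u : Fin n → ℝ, ENNReal.ofReal (Real.exp
      ((h * ‖W.starProjection (tl u)‖ ^ 2 + inner ℝ bv (tl u)) - a)) =
      ENNReal.ofReal (Real.exp (-a)) * ENNReal.ofReal (Real.exp (
        (h * ‖W.starProjection (tl u)‖ ^ 2 + inner ℝ (W.starProjection bv) (tl u)) +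
        (0 * ‖Wᗮ.starProjection (tl u)‖ ^ 2 + inner ℝ (Wᗮ.starProjection bv) (tl u)))) := by
    intro u
    rw [← ENNReal.ofReal_mul (Real.exp_pos _).le, ← Real.exp_add]
    congr 2
    have : inner ℝ bv (tl u) = inner ℝ (W.starProjection bv) (tl u) +
        inner ℝ (Wᗮ.starProjection bv) (tl u) := by
      rw [← inner_add_left, Submodule.starProjection_add_starProjection_orthogonal]
    rw [this]; ring
  simp_rw [e]
  rw [lintegral_const_mul _ (by fun_prop), key, ← ENNReal.ofReal_mul (Real.exp_pos _).le]
  apply ENNReal.ofReal_le_ofReal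
  have hsq := Submodule.norm_sq_eq_add_norm_sq_starProjection bv W
  have hp : 0 < 1 - 2 * h := by linarith
  have h1 : ‖W.starProjection bv‖ ^ 2 / (2 * (1 - 2 * h)) + ‖Wᗮ.starProjection bv‖ ^ 2 / (2 * (1 - 2 * 0))
      ≤ ‖bv‖ ^ 2 / (2 * (1 - 2 * h)) := by
    rw [hsq, add_div]
    gcongr
  calc _ = (1 / Real.sqrt (1 - 2 * h)) ^ (Module.finrank ℝ W) * Real.exp (‖W.starProjection bv‖ ^ 2 / (2 * (1 - 2 * h)) + ‖Wᗮ.starProjection bv‖ ^ 2 / (2 * (1 - 2 * 0)) - a) := by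
        rw [sub_eq_add_neg _ a, Real.exp_add, Real.exp_add]; simp; ring
    _ ≤ _ := by
        gcongr ?_ * Real.exp (?_ - a)
        exact one_div_sqrt_pow_le h0 hh hm

lemma pyth {n : ℕ} (A W : Submodule ℝ (EE n)) (hAW : A ≤ W) (u : EE n) :
    ‖W.starProjection u‖ ^ 2 = ‖A.starProjection u‖ ^ 2 + ‖(Aᗮ ⊓ W).starProjection u‖ ^ 2 := by
  have hB : (Aᗮ ⊓ W).starProjection u = W.starProjection u - A.starProjection u := by
    have h1 : W.starProjection u - A.starProjection u ∈ Aᗮ := by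
      have : W.starProjection u - A.starProjection u =
        (u - A.starProjection u) - (u - W.starProjection u) := by abel
      rw [this]
      exact Submodule.sub_mem _ (A.sub_starProjection_mem_orthogonal u)
        (Submodule.orthogonal_le hAW (W.sub_starProjection_mem_orthogonal u))
    apply Submodule.eq_starProjection_of_mem_orthogonal
    · exact ⟨h1, Submodule.sub_mem _ (Submodule.starProjection_apply_mem _ _)
        (hAW (Submodule.starProjection_apply_mem _ _))⟩
    · have : u - (W.starProjection u - A.starProjection u) =
        (u - W.starProjection u) + A.starProjection u := by abel
      rw [this]
      refine Submodule.add_mem _ (Submodule.orthogonal_le inf_le_right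
        (W.sub_starProjection_mem_orthogonal u)) (Submodule.orthogonal_le inf_le_left
          (Submodule.le_orthogonal_orthogonal _ (Submodule.starProjection_apply_mem _ _)))
  have h2 : W.starProjection u = A.starProjection u + (Aᗮ ⊓ W).starProjection u := by
    rw [hB]; abel
  have h3 : inner ℝ (A.starProjection u) ((Aᗮ ⊓ W).starProjection u) = 0 :=
    (Submodule.mem_orthogonal _ _).1
      (Submodule.starProjection_apply_mem (Aᗮ ⊓ W) u).1 _ (Submodule.starProjection_apply_mem A u)
  rw [h2]
  have := norm_add_sq_eq_norm_sq_add_norm_sq_of_inner_eq_zero _ _ h3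
  nlinarith [this]

lemma cap {n : ℕ} (W : Submodule ℝ (EE n)) (e : EE n) (heW : e ∈ W) (he : e ≠ 0) (D : ℕ)
    (hD : D + 1 ≤ Module.finrank ℝ W) :
    stdGaussian n {u | 0.7 * ‖e‖ ^ 2 * ‖W.starProjection (tl u)‖ ^ 2 < (inner ℝ e (tl u)) ^ 2} ≤
      ENNReal.ofReal (2 * (1 / Real.sqrt (11/4)) ^ D) := by
  have hmt := measurable_tl (n := n)
  set A := Submodule.span ℝ {e} with hA
  have hAW : A ≤ W := by rw [hA, Submodule.span_singleton_le_iff_mem]; exact heW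
  have hfin := Submodule.finrank_add_inf_finrank_orthogonal hAW
  have hA1 : Module.finrank ℝ A = 1 := finrank_span_singleton he
  have hn : 0 < ‖e‖ := norm_pos_iff.2 he
  have hPA : ∀ x : EE n, ‖A.starProjection x‖ ^ 2 * ‖e‖ ^ 2 = (inner ℝ e x) ^ 2 := by
    intro x
    have : A.starProjection x = (inner ℝ e x / ‖e‖ ^ 2) • e := by
      have := Submodule.starProjection_singleton ℝ (v := e) x
      simpa using this
    rw [this, norm_smul, mul_pow]
    simp
    field_simp
    rw [sq_abs]
  refine (markov_exp _ (fun u => (3/8 * ‖A.starProjection (tl u)‖ ^ 2 + inner ℝ (A.starProjection 0) (tl u)) +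
        ((-7/8) * ‖(Aᗮ ⊓ W).starProjection (tl u)‖ ^ 2 + inner ℝ ((Aᗮ ⊓ W).starProjection 0) (tl u)))
        (by fun_prop) ?_).trans ?_
  · intro u hu
    simp only [Set.mem_ofPred_eq] at hu
    rw [pyth A W hAW, ← hPA] at hu
    simp only [map_zero, inner_zero_left, add_zero]
    have : (0.7 * (‖A.starProjection (tl u)‖ ^ 2 + ‖(Aᗮ ⊓ W).starProjection (tl u)‖ ^ 2)) * ‖e‖^2 <
      (‖A.starProjection (tl u)‖ ^ 2) * ‖e‖ ^ 2 := by linarith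
    have := lt_of_mul_lt_mul_right this (by positivity)
    linarith
  · rw [mgf2 A (Aᗮ ⊓ W) _ _ _ (by norm_num) (by norm_num)]
    · apply ENNReal.ofReal_le_ofReal
      simp only [map_zero, norm_zero, hA1]
      have h4 : Real.sqrt (1 - 2 * (3/8)) = 1/2 := by
        rw [show (1 - 2 * (3/8) : ℝ) = (1/2)^2 by norm_num]; exact Real.sqrt_sq (by norm_num)
      have h5 : (1 - 2 * (-7/8) : ℝ) = 11/4 := by norm_num
      rw [h4, h5]
      norm_num
      apply pow_le_pow_of_le_one
      · positivity
      · rw [div_le_one (by positivity)]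
        exact Real.le_sqrt_of_sq_le (by norm_num)
      · omega
    · rw [Submodule.isOrtho_iff_le]
      intro x hx
      exact Submodule.orthogonal_le inf_le_left (Submodule.le_orthogonal_orthogonal _ hx)


end

section


lemma sqnorm_eq {n : ℕ} (v : Fin n → ℝ) : sqnorm v = ‖tl v‖ ^ 2 := by
  rw [EuclideanSpace.real_norm_sq_eq]; rfl

def colv {n p : ℕ} (X : Matrix (Fin n) (Fin p) ℝ) (j : Fin p) : EE n := tl (fun i => X i j)

def Sp {n p : ℕ} (X : Matrix (Fin n) (Fin p) ℝ) (τ : Finset (Fin p)) : Submodule ℝ (EE n) :=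
  Submodule.span ℝ (colv X '' (τ : Set (Fin p)))

def Ks {n p : ℕ} (X : Matrix (Fin n) (Fin p) ℝ) (τ : Finset (Fin p)) (u : Fin n → ℝ) :
    Submodule ℝ (EE n) := Sp X τ ⊔ Submodule.span ℝ {tl u}

variable {n p : ℕ} (X : Matrix (Fin n) (Fin p) ℝ)

lemma tl_mulVec (β : Fin p → ℝ) : tl (X.mulVec β) = ∑ j, β j • colv X j := by
  ext i
  simp [colv, Matrix.mulVec, dotProduct, mul_comm]

lemma tl_mulVec_mask (τ : Finset (Fin p)) (β : Fin p → ℝ) :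
    tl (X.mulVec (maskOn τ β)) = ∑ j ∈ τ, β j • colv X j := by
  rw [tl_mulVec]
  simp [maskOn, ite_smul, Finset.sum_ite_mem]

lemma mask_mem (τ : Finset (Fin p)) (β : Fin p → ℝ) : tl (X.mulVec (maskOn τ β)) ∈ Sp X τ := by
  rw [tl_mulVec_mask]
  exact Submodule.sum_mem _ fun j hj => Submodule.smul_mem _ _
    (Submodule.subset_span ⟨j, hj, rfl⟩)

lemma exists_mask (τ : Finset (Fin p)) (x : EE n) (hx : x ∈ Sp X τ) :
    ∃ β : Fin p → ℝ, tl (X.mulVec (maskOn τ β)) = x := by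
  induction hx using Submodule.span_induction with
  | mem x h =>
    obtain ⟨j, hj, rfl⟩ := h
    refine ⟨Pi.single j 1, ?_⟩
    rw [tl_mulVec_mask]
    rw [Finset.sum_eq_single j]
    · simp
    · intro b _ hb; simp [hb]
    · intro h; exact absurd hj h
  | zero => exact ⟨0, by rw [tl_mulVec_mask]; simp⟩
  | add x y _ _ hx hy =>
    obtain ⟨a, ha⟩ := hx
    obtain ⟨b, hb⟩ := hy
    refine ⟨a + b, ?_⟩
    rw [tl_mulVec_mask] at *
    rw [← ha, ← hb, ← Finset.sum_add_distrib]
    simp [add_smul]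
  | smul c x _ hx =>
    obtain ⟨a, ha⟩ := hx
    refine ⟨c • a, ?_⟩
    rw [tl_mulVec_mask] at *
    rw [← ha, Finset.smul_sum]
    simp [mul_smul]

lemma Q_eq (K : Submodule ℝ (EE n)) (y : EE n) : Kᗮ.starProjection y = y - K.starProjection y :=
  Submodule.starProjection_orthogonal_val y

lemma Q_le (K : Submodule ℝ (EE n)) (y x : EE n) (hx : x ∈ K) :
    ‖Kᗮ.starProjection y‖ ^ 2 ≤ ‖y - x‖ ^ 2 := by
  have h : Kᗮ.starProjection (y - x) = Kᗮ.starProjection y := by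
    rw [map_sub, Q_eq K x, Submodule.starProjection_eq_self_iff.2 hx]; simp
  rw [← h]
  have := Submodule.norm_sq_eq_add_norm_sq_starProjection (y - x) Kᗮ
  nlinarith [sq_nonneg ‖Kᗮᗮ.starProjection (y - x)‖]

lemma fit_eq (y u : Fin n → ℝ) (τ : Finset (Fin p)) :
    (⨅ bs : (Fin p → ℝ) × ℝ, sqnorm (y - X.mulVec (maskOn τ bs.1) - bs.2 • u)) =
      ‖(Ks X τ u)ᗮ.starProjection (tl y)‖ ^ 2 := by
  have hb : BddBelow (Set.range fun bs : (Fin p → ℝ) × ℝ =>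
      sqnorm (y - X.mulVec (maskOn τ bs.1) - bs.2 • u)) :=
    ⟨0, by rintro _ ⟨bs, rfl⟩; simp only [sqnorm]; positivity⟩
  have e : ∀ bs : (Fin p → ℝ) × ℝ, tl (y - X.mulVec (maskOn τ bs.1) - bs.2 • u) =
      tl y - (tl (X.mulVec (maskOn τ bs.1)) + bs.2 • tl u) := by
    intro bs; ext i; simp; ring
  apply le_antisymm
  · have hm := (Ks X τ u).starProjection_apply_mem (tl y)
    obtain ⟨a, ha, b, hb', hab⟩ := Submodule.mem_sup.1 hm
    obtain ⟨s, rfl⟩ := Submodule.mem_span_singleton.1 hb'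
    obtain ⟨β, rfl⟩ := exists_mask X τ a ha
    refine (ciInf_le hb (β, s)).trans ?_
    simp only
    rw [sqnorm_eq, e (β, s)]
    simp only
    rw [hab, Q_eq]
  · apply le_ciInf
    intro bs
    rw [sqnorm_eq, e bs]
    apply Q_le
    exact Submodule.add_mem_sup (mask_mem X τ _)
      (Submodule.smul_mem _ _ (Submodule.mem_span_singleton_self _))

lemma objPen_eq (lam : ℝ) (y u : Fin n → ℝ) (τ : Finset (Fin p)) :
    objPen X lam y u τ = ‖(Ks X τ u)ᗮ.starProjection (tl y)‖ ^ 2 + lam * τ.card := by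
  rw [objPen, fit_eq]

lemma objPen_meas (lam : ℝ) (τ : Finset (Fin p)) :
    Measurable (fun z : (Fin n → ℝ) × (Fin n → ℝ) => objPen X lam z.1 z.2 τ) := by
  unfold objPen
  refine Measurable.add_const ?_ _
  apply UpperSemicontinuous.measurable
  apply upperSemicontinuous_ciInf
  · intro z
    exact ⟨0, by rintro _ ⟨bs, rfl⟩; simp only [sqnorm]; positivity⟩
  · intro bs
    apply Continuous.upperSemicontinuous
    unfold sqnorm
    simp only [Pi.sub_apply, Pi.smul_apply]
    fun_prop

lemma Sp_mono {τ τ' : Finset (Fin p)} (h : τ ⊆ τ') : Sp X τ ≤ Sp X τ' :=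
  Submodule.span_mono (Set.image_mono (by exact_mod_cast h))

lemma Ks_mono {τ τ' : Finset (Fin p)} (h : τ ⊆ τ') (u : Fin n → ℝ) : Ks X τ u ≤ Ks X τ' u :=
  sup_le_sup_right (Sp_mono X h) _

lemma finrank_Sp (τ : Finset (Fin p)) : Module.finrank ℝ (Sp X τ) ≤ τ.card := by
  have h1 := finrank_span_finset_le_card (R := ℝ) (τ.image (colv X))
  rw [Set.finrank, Finset.coe_image] at h1
  exact h1.trans Finset.card_image_le

lemma finrank_Sp_orth (τ : Finset (Fin p)) : n ≤ Module.finrank ℝ (Sp X τ)ᗮ + τ.card := by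
  have h1 := Submodule.finrank_add_finrank_orthogonal (Sp X τ)
  have h2 := finrank_Sp X τ
  rw [finrank_euclideanSpace_fin] at h1
  omega

lemma finrank_W (τ₀ τ : Finset (Fin p)) (u : Fin n → ℝ) :
    Module.finrank ℝ (((Ks X τ₀ u)ᗮ ⊓ Ks X (τ₀ ∪ τ) u : Submodule ℝ (EE n))) ≤ (τ \ τ₀).card := by
  have h1 := Submodule.finrank_add_inf_finrank_orthogonal
    (Ks_mono X (Finset.subset_union_left (s₁ := τ₀) (s₂ := τ)) u)
  have h2 : Ks X (τ₀ ∪ τ) u ≤ Ks X τ₀ u ⊔ Sp X (τ \ τ₀) := by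
    unfold Ks
    refine sup_le ?_ (le_sup_right.trans le_sup_left)
    unfold Sp
    rw [Submodule.span_le]
    rintro _ ⟨j, hj, rfl⟩
    by_cases hj0 : j ∈ τ₀
    · exact (le_sup_left.trans le_sup_left : Sp X τ₀ ≤ _) (Submodule.subset_span ⟨j, hj0, rfl⟩)
    · have : j ∈ τ \ τ₀ := by
        simp at hj ⊢; tauto
      exact (le_sup_right : Sp X (τ \ τ₀) ≤ _) (Submodule.subset_span ⟨j, this, rfl⟩)
  have h3 := Submodule.finrank_mono h2
  have h4 := Submodule.finrank_add_le_finrank_add_finrank (Ks X τ₀ u) (Sp X (τ \ τ₀))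
  have h5 := finrank_Sp X (τ \ τ₀)
  omega

lemma subcols_mulVec (τ : Finset (Fin p)) (b : {j // j ∈ τ} → ℝ) :
    tl ((subcols X τ).mulVec b) ∈ Sp X τ := by
  have : tl ((subcols X τ).mulVec b) = ∑ j, b j • colv X j.1 := by
    ext i
    simp [colv, Matrix.mulVec, dotProduct, mul_comm, subcols]
  rw [this]
  exact Submodule.sum_mem _ fun j _ => Submodule.smul_mem _ _
    (Submodule.subset_span ⟨j.1, j.2, rfl⟩)

lemma proj_symm {m : Type} [Fintype m] [DecidableEq m] (M : Matrix (Fin n) m ℝ) :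
    (projMat M)ᵀ = projMat M := by
  unfold projMat
  simp [Matrix.transpose_mul, Matrix.mul_assoc, Matrix.transpose_nonsing_inv]

lemma projMat_mul {m : Type} [Fintype m] [DecidableEq m] (M : Matrix (Fin n) m ℝ)
    (h : IsUnit (Mᵀ * M).det) : projMat M * M = M := by
  unfold projMat
  rw [Matrix.mul_assoc, Matrix.mul_assoc, Matrix.nonsing_inv_mul _ h, Matrix.mul_one]

lemma mul_projMat {m : Type} [Fintype m] [DecidableEq m] (M : Matrix (Fin n) m ℝ)
    (h : IsUnit (Mᵀ * M).det) : Mᵀ * projMat M = Mᵀ := by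
  unfold projMat
  rw [← Matrix.mul_assoc, ← Matrix.mul_assoc, Matrix.mul_nonsing_inv _ h, Matrix.one_mul]

lemma proj_eq (τ : Finset (Fin p)) (h : IsUnit ((subcols X τ)ᵀ * subcols X τ).det)
    (w : Fin n → ℝ) :
    tl ((1 - proj X τ).mulVec w) = (Sp X τ)ᗮ.starProjection (tl w) := by
  have h1 : (Sp X τ).starProjection (tl w) = tl ((proj X τ).mulVec w) := by
    apply Submodule.eq_starProjection_of_mem_orthogonal
    · have : (proj X τ).mulVec w = (subcols X τ).mulVec
          ((((subcols X τ)ᵀ * subcols X τ)⁻¹ * (subcols X τ)ᵀ).mulVec w) := by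
        rw [Matrix.mulVec_mulVec, ← Matrix.mul_assoc]; rfl
      rw [this]
      exact subcols_mulVec X τ _
    · have hz : (subcols X τ)ᵀ.mulVec (w - (proj X τ).mulVec w) = 0 := by
        rw [Matrix.mulVec_sub, Matrix.mulVec_mulVec, proj, mul_projMat _ h, sub_self]
      unfold Sp
      rw [Submodule.mem_orthogonal]
      intro x hx
      induction hx using Submodule.span_induction with
      | mem x hx =>
        obtain ⟨j, hj, rfl⟩ := hx
        have := congrFun hz ⟨j, hj⟩
        simp only [Matrix.mulVec, dotProduct, Matrix.transpose_apply, subcols, Matrix.of_apply,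
          Pi.zero_apply, Pi.sub_apply] at this
        rw [PiLp.inner_apply]
        simpa [colv, Matrix.mulVec, dotProduct, mul_comm] using this
      | zero => simp
      | add x y _ _ hx hy => rw [inner_add_left, hx, hy, add_zero]
      | smul c x _ hx => rw [real_inner_smul_left, hx, mul_zero]
  rw [Q_eq, h1, Matrix.sub_mulVec, Matrix.one_mulVec]
  rfl


end

section


variable {n p : ℕ} (X : Matrix (Fin n) (Fin p) ℝ)

abbrev Wsub (τ₀ A : Finset (Fin p)) (u : Fin n → ℝ) : Submodule ℝ (EE n) :=
  (Ks X τ₀ u)ᗮ ⊓ Ks X (τ₀ ∪ A) u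

lemma Q_zero (K : Submodule ℝ (EE n)) (x : EE n) (hx : x ∈ K) : Kᗮ.starProjection x = 0 := by
  rw [Q_eq, Submodule.starProjection_eq_self_iff.2 hx, sub_self]

lemma Q_diff (K₀ K₁ : Submodule ℝ (EE n)) (h : K₀ ≤ K₁) (x : EE n) :
    ‖K₀ᗮ.starProjection x‖ ^ 2 = ‖K₁ᗮ.starProjection x‖ ^ 2 + ‖(K₀ᗮ ⊓ K₁).starProjection x‖ ^ 2 := by
  have h1 := Submodule.norm_sq_eq_add_norm_sq_starProjection x K₀
  have h2 := Submodule.norm_sq_eq_add_norm_sq_starProjection x K₁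
  have h3 := pyth K₀ K₁ h x
  linarith

lemma Q_anti (K₀ K₁ : Submodule ℝ (EE n)) (h : K₀ ≤ K₁) (x : EE n) :
    ‖K₁ᗮ.starProjection x‖ ^ 2 ≤ ‖K₀ᗮ.starProjection x‖ ^ 2 := by
  rw [Q_diff K₀ K₁ h x]
  linarith [sq_nonneg ‖(K₀ᗮ ⊓ K₁).starProjection x‖]

lemma mean_mem (τ₀ : Finset (Fin p)) (β₀ : Fin p → ℝ) (hβ : ∀ j ∉ τ₀, β₀ j = 0) :
    tl (X.mulVec β₀) ∈ Sp X τ₀ := by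
  have : maskOn τ₀ β₀ = β₀ := by
    ext j; unfold maskOn; split_ifs with h
    · rfl
    · exact (hβ j h).symm
  rw [← this]; exact mask_mem X τ₀ β₀

lemma tl_y (m u : Fin n → ℝ) (σ : ℝ) : tl (m + σ • u) = tl m + σ • tl u := by
  ext i; simp

lemma Q_noise (K : Submodule ℝ (EE n)) (m u : Fin n → ℝ) (σ : ℝ) (hm : tl m ∈ K) :
    ‖Kᗮ.starProjection (tl (m + σ • u))‖ ^ 2 = σ ^ 2 * ‖Kᗮ.starProjection (tl u)‖ ^ 2 := by
  rw [tl_y, map_add, Q_zero K _ hm, zero_add, map_smul, norm_smul, mul_pow, Real.norm_eq_abs, sq_abs]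

lemma Ks_mem {τ : Finset (Fin p)} {x : EE n} (u : Fin n → ℝ) (h : x ∈ Sp X τ) : x ∈ Ks X τ u :=
  (le_sup_left : Sp X τ ≤ _) h

/-- overfit reduction -/
lemma over_red (τ₀ τ : Finset (Fin p)) (m : Fin n → ℝ) (hm : tl m ∈ Sp X τ₀) (σ lam : ℝ)
    (u ustar : Fin n → ℝ)
    (h : objPen X lam (m + σ • u) ustar τ ≤ objPen X lam (m + σ • u) ustar τ₀) :
    lam * ((τ.card : ℝ) - τ₀.card) ≤ σ ^ 2 * ‖(Wsub X τ₀ (τ \ τ₀) ustar).starProjection (tl u)‖ ^ 2 := by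
  rw [objPen_eq, objPen_eq] at h
  have e : τ₀ ∪ τ \ τ₀ = τ₀ ∪ τ := by simp
  have h01 : Ks X τ₀ ustar ≤ Ks X (τ₀ ∪ τ \ τ₀) ustar := Ks_mono X Finset.subset_union_left _
  have h11 : Ks X τ ustar ≤ Ks X (τ₀ ∪ τ \ τ₀) ustar := by
    rw [e]; exact Ks_mono X Finset.subset_union_right _
  have h1 := Q_anti _ _ h11 (tl (m + σ • u))
  rw [Q_noise _ m u σ (h01 (Ks_mem X _ hm))] at h1
  rw [Q_noise _ m u σ (Ks_mem X ustar hm)] at h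
  rw [Q_diff _ _ h01 (tl u)] at h
  have : σ ^ 2 * ‖(Wsub X τ₀ (τ \ τ₀) ustar).starProjection (tl u)‖ ^ 2 =
    σ ^ 2 * ‖((Ks X τ₀ ustar)ᗮ ⊓ Ks X (τ₀ ∪ τ \ τ₀) ustar).starProjection (tl u)‖ ^ 2 := rfl
  rw [this]
  linarith

/-- underfit reduction -/
lemma under_red (τ₀ τ : Finset (Fin p)) (m : Fin n → ℝ) (hm : tl m ∈ Sp X τ₀) (σ lam : ℝ)
    (u ustar : Fin n → ℝ)
    (h : objPen X lam (m + σ • u) ustar τ ≤ objPen X lam (m + σ • u) ustar τ₀) :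
    ‖(Ks X τ ustar)ᗮ.starProjection (tl m)‖ ^ 2 - lam * ((τ₀.card : ℝ) - τ.card) ≤
      σ ^ 2 * ‖(Wsub X τ₀ (τ \ τ₀) ustar).starProjection (tl u)‖ ^ 2
      - 2 * σ * inner ℝ ((Ks X τ ustar)ᗮ.starProjection (tl m)) (tl u) := by
  rw [objPen_eq, objPen_eq] at h
  have e : τ₀ ∪ τ \ τ₀ = τ₀ ∪ τ := by simp
  have h01 : Ks X τ₀ ustar ≤ Ks X (τ₀ ∪ τ \ τ₀) ustar := Ks_mono X Finset.subset_union_left _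
  have h11 : Ks X τ ustar ≤ Ks X (τ₀ ∪ τ \ τ₀) ustar := by
    rw [e]; exact Ks_mono X Finset.subset_union_right _
  have h1 := Q_anti _ _ h11 (tl u)
  rw [Q_noise _ m u σ (Ks_mem X ustar hm)] at h
  rw [Q_diff _ _ h01 (tl u)] at h
  have h2 : ‖(Ks X τ ustar)ᗮ.starProjection (tl (m + σ • u))‖ ^ 2 =
      ‖(Ks X τ ustar)ᗮ.starProjection (tl m)‖ ^ 2 +
      2 * σ * inner ℝ ((Ks X τ ustar)ᗮ.starProjection (tl m)) (tl u) +
      σ ^ 2 * ‖(Ks X τ ustar)ᗮ.starProjection (tl u)‖ ^ 2 := by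
    rw [tl_y, map_add, map_smul, norm_add_sq_real, norm_smul, mul_pow, Real.norm_eq_abs, sq_abs,
      real_inner_smul_right]
    have h3 := (Ks X τ ustar)ᗮ.inner_starProjection_left_eq_right
      ((Ks X τ ustar)ᗮ.starProjection (tl m)) (tl u)
    rw [← h3, Submodule.starProjection_eq_self_iff.2 (Submodule.starProjection_apply_mem _ _)]
    ring
  have h4 := mul_le_mul_of_nonneg_left h1 (sq_nonneg σ)
  have : σ ^ 2 * ‖(Wsub X τ₀ (τ \ τ₀) ustar).starProjection (tl u)‖ ^ 2 =
    σ ^ 2 * ‖((Ks X τ₀ ustar)ᗮ ⊓ Ks X (τ₀ ∪ τ \ τ₀) ustar).starProjection (tl u)‖ ^ 2 := rfl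
  rw [this]
  linarith

lemma Q_rank_one (τ : Finset (Fin p)) (m ustar : Fin n → ℝ)
    (h : (inner ℝ ((Sp X τ)ᗮ.starProjection (tl m)) (tl ustar)) ^ 2 ≤
      0.7 * ‖(Sp X τ)ᗮ.starProjection (tl m)‖ ^ 2 * ‖(Sp X τ)ᗮ.starProjection (tl ustar)‖ ^ 2) :
    0.3 * ‖(Sp X τ)ᗮ.starProjection (tl m)‖ ^ 2 ≤ ‖(Ks X τ ustar)ᗮ.starProjection (tl m)‖ ^ 2 := by
  have hm := (Ks X τ ustar).starProjection_apply_mem (tl m)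
  obtain ⟨a, ha, b, hb', hab⟩ := Submodule.mem_sup.1 hm
  obtain ⟨s, rfl⟩ := Submodule.mem_span_singleton.1 hb'
  rw [Q_eq (Ks X τ ustar), ← hab]
  have h1 : ‖(Sp X τ)ᗮ.starProjection (tl m - s • tl ustar)‖ ^ 2 ≤ ‖tl m - (a + s • tl ustar)‖ ^ 2 := by
    have := Q_le (Sp X τ) (tl m - s • tl ustar) a ha
    rwa [show tl m - s • tl ustar - a = tl m - (a + s • tl ustar) by abel] at this
  refine le_trans ?_ h1
  rw [map_sub, map_smul, norm_sub_sq_real, norm_smul, mul_pow, Real.norm_eq_abs, sq_abs,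
    real_inner_smul_right]
  have h3 := (Sp X τ)ᗮ.inner_starProjection_left_eq_right
      ((Sp X τ)ᗮ.starProjection (tl m)) (tl ustar)
  rw [← h3, Submodule.starProjection_eq_self_iff.2 (Submodule.starProjection_apply_mem _ _)]
  set x := ‖(Sp X τ)ᗮ.starProjection (tl m)‖ ^ 2
  set y := ‖(Sp X τ)ᗮ.starProjection (tl ustar)‖ ^ 2
  set z : ℝ := inner ℝ ((Sp X τ)ᗮ.starProjection (tl m)) (tl ustar)
  have hx : 0 ≤ x := by positivity
  have hy : 0 ≤ y := by positivity
  rcases hy.eq_or_lt with hy0 | hy0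
  · have : z = 0 := by
      rw [← hy0, mul_zero] at h
      exact pow_eq_zero_iff (two_ne_zero) |>.1 (le_antisymm h (sq_nonneg z))
    rw [this, ← hy0]; linarith
  · have : 0 ≤ y * (0.7 * x - 2 * (s * z) + s ^ 2 * y) := by
      nlinarith [sq_nonneg (s * y - z)]
    have := nonneg_of_mul_nonneg_right this hy0
    linarith

lemma over_chern (τ₀ A : Finset (Fin p)) (hA : A ⊆ τ₀ᶜ) (σ a : ℝ) (hσ : 0 < σ) (ustar : Fin n → ℝ) :
    stdGaussian n {u | a ≤ σ ^ 2 * ‖(Wsub X τ₀ A ustar).starProjection (tl u)‖ ^ 2} ≤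
      ENNReal.ofReal (Real.sqrt 3 ^ A.card * Real.exp (-(a / (3 * σ ^ 2)))) := by
  have hW : Module.finrank ℝ (Wsub X τ₀ A ustar) ≤ A.card := by
    refine (finrank_W X τ₀ A ustar).trans (Finset.card_le_card Finset.sdiff_subset)
  refine (chern1 (Wsub X τ₀ A ustar) (1/3) (by norm_num) (by norm_num) 0 A.card hW (a / (3 * σ ^ 2)) _
    ?_).trans ?_
  · intro u hu
    simp only [Set.mem_ofPred_eq] at hu
    rw [div_le_iff₀ (by positivity)]
    simp
    linarith
  · apply le_of_eq
    have : 1 / Real.sqrt (1 - 2 * (1/3)) = Real.sqrt 3 := by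
      rw [show (1 - 2 * (1/3) : ℝ) = 3⁻¹ by norm_num, Real.sqrt_inv]; simp
    rw [this]; simp

lemma under_chern (τ₀ τ : Finset (Fin p)) (m : Fin n → ℝ) (hm : tl m ∈ Sp X τ₀) (σ lam N : ℝ)
    (hσ : 0 < σ) (hN : 0 ≤ N) (ustar : Fin n → ℝ)
    (h1 : 0.3 * (N * σ ^ 2) ≤ ‖(Ks X τ ustar)ᗮ.starProjection (tl m)‖ ^ 2)
    (h2 : lam * ((τ₀.card : ℝ) - τ.card) ≤ 0.05 * (N * σ ^ 2)) :
    stdGaussian n {u | objPen X lam (m + σ • u) ustar τ ≤ objPen X lam (m + σ • u) ustar τ₀} ≤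
      ENNReal.ofReal ((1 / Real.sqrt (3/4)) ^ (τ \ τ₀).card * Real.exp (- (N / 60))) := by
  have hW : Module.finrank ℝ (Wsub X τ₀ (τ \ τ₀) ustar) ≤ (τ \ τ₀).card := by
    refine (finrank_W X τ₀ (τ \ τ₀) ustar).trans (Finset.card_le_card Finset.sdiff_subset)
  set q := (Ks X τ ustar)ᗮ.starProjection (tl m) with hq
  refine (chern1 (Wsub X τ₀ (τ \ τ₀) ustar) (1/8) (by norm_num) (by norm_num) (-(1/(4*σ)) • q)
    _ hW ((‖q‖ ^ 2 - 0.05 * (N * σ ^ 2)) / (8 * σ ^ 2)) _ ?_).trans ?_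
  · intro u hu
    simp only [Set.mem_ofPred_eq] at hu
    have := under_red X τ₀ τ m hm σ lam u ustar hu
    rw [← hq] at this
    rw [div_le_iff₀ (by positivity), real_inner_smul_left]
    have e : (1/8 * ‖(Wsub X τ₀ (τ \ τ₀) ustar).starProjection (tl u)‖ ^ 2 + -(1/(4*σ)) * inner ℝ q (tl u))
      * (8 * σ ^ 2) = σ ^ 2 * ‖(Wsub X τ₀ (τ \ τ₀) ustar).starProjection (tl u)‖ ^ 2
      - 2 * σ * inner ℝ q (tl u) := by field_simp; ring
    rw [e]
    linarith
  · apply ENNReal.ofReal_le_ofReal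
    rw [show (1 - 2 * (1/8) : ℝ) = 3/4 by norm_num]
    gcongr
    rw [norm_smul, mul_pow]
    have e : ‖-(1/(4*σ))‖ ^ 2 * ‖q‖ ^ 2 / (2 * (3/4)) - (‖q‖ ^ 2 - 0.05 * (N * σ ^ 2)) / (8 * σ ^ 2)
      = -(‖q‖ ^ 2 / σ ^ 2) / 12 + 0.05/8 * N := by
      rw [Real.norm_eq_abs, sq_abs]; field_simp; ring
    rw [e]
    have : 0.3 * N ≤ ‖q‖ ^ 2 / σ ^ 2 := by
      rw [le_div_iff₀ (by positivity)]; linarith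
    linarith


end

section


lemma sum_pow_card {ι : Type*} (s : Finset ι) (x : ℝ) :
    ∑ A ∈ s.powerset, x ^ A.card = (1 + x) ^ s.card := by
  have := Finset.sum_pow_mul_eq_add_pow x 1 s
  simp only [one_pow, mul_one] at this
  rw [this, add_comm]

lemma sum_pow_card_ne {ι : Type*} [DecidableEq ι] (s : Finset ι) (x : ℝ) :
    ∑ A ∈ s.powerset.erase ∅, x ^ A.card = (1 + x) ^ s.card - 1 := by
  have h := Finset.add_sum_erase s.powerset (fun A => x ^ A.card) (Finset.empty_mem_powerset s)
  rw [sum_pow_card] at h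
  simp only [Finset.card_empty, pow_zero] at h
  linarith

lemma measure_union_real {Ω ι : Type*} [MeasurableSpace Ω] (μ : Measure Ω) (s : Finset ι)
    (S : Set Ω) (E : ι → Set Ω) (f : ι → ℝ) (hf : ∀ i ∈ s, 0 ≤ f i)
    (hS : S ⊆ ⋃ i ∈ s, E i) (hE : ∀ i ∈ s, μ (E i) ≤ ENNReal.ofReal (f i)) (c : ℝ)
    (hc : ∑ i ∈ s, f i ≤ c) : μ S ≤ ENNReal.ofReal c := by
  calc μ S ≤ μ (⋃ i ∈ s, E i) := measure_mono hS
    _ ≤ ∑ i ∈ s, μ (E i) := measure_biUnion_finset_le _ _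
    _ ≤ ∑ i ∈ s, ENNReal.ofReal (f i) := Finset.sum_le_sum hE
    _ = ENNReal.ofReal (∑ i ∈ s, f i) := (ENNReal.ofReal_sum_of_nonneg hf).symm
    _ ≤ _ := ENNReal.ofReal_le_ofReal hc

lemma sqrt3_lt : Real.sqrt 3 < 1.7321 := by
  rw [Real.sqrt_lt' (by norm_num)]; norm_num

lemma exp_le_inv (x : ℝ) (h : x < 1) : Real.exp x ≤ 1 / (1 - x) := by
  have h1 := Real.add_one_le_exp (-x)
  rw [Real.exp_neg] at h1
  rw [le_div_iff₀ (by linarith)]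
  have h2 := Real.exp_pos x
  calc Real.exp x * (1 - x) ≤ Real.exp x * (Real.exp x)⁻¹ := by
        apply mul_le_mul_of_nonneg_left _ h2.le; linarith
    _ = 1 := mul_inv_cancel₀ h2.ne'

lemma over_num (p : ℕ) (hp : 2 ≤ p) : (1 + Real.sqrt 3 * (4 / (p:ℝ) ^ 2)) ^ (p - 1) ≤ 3.25 := by
  have h3 := sqrt3_lt
  have h30 := Real.sqrt_nonneg 3
  have key : ∀ q : ℕ, ∀ x : ℝ, 1 + Real.sqrt 3 * (4 / (p:ℝ) ^ 2) ≤ x → x ^ q ≤ 3.25 →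
      (1 + Real.sqrt 3 * (4 / (p:ℝ) ^ 2)) ^ q ≤ 3.25 := by
    intro q x h1 h2
    refine le_trans (pow_le_pow_left₀ (by positivity) h1 _) h2
  rcases lt_or_ge p 5 with h | h
  · interval_cases p
    · apply key _ 2.7321 <;> norm_num; norm_num at h3; linarith
    · apply key _ 1.77 <;> norm_num; norm_num at h3; linarith
    · apply key _ 1.44 <;> norm_num; norm_num at h3; linarith
  · have hp' : (5:ℝ) ≤ p := by exact_mod_cast h
    have e1 : (1 + Real.sqrt 3 * (4 / (p:ℝ) ^ 2)) ^ (p - 1) ≤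
        Real.exp (((p - 1 : ℕ):ℝ) * (Real.sqrt 3 * (4 / (p:ℝ) ^ 2))) := by
      rw [Real.exp_nat_mul]
      apply pow_le_pow_left₀ (by positivity)
      have := Real.add_one_le_exp (Real.sqrt 3 * (4 / (p:ℝ) ^ 2)); linarith
    have e2 : ((p - 1 : ℕ):ℝ) * (Real.sqrt 3 * (4 / (p:ℝ) ^ 2)) ≤ 1 + 0.11 := by
      have : ((p - 1 : ℕ):ℝ) = p - 1 := by rw [Nat.cast_sub (by omega)]; simp
      rw [this]
      have : ((p:ℝ) - 1) / p ^ 2 ≤ 4 / 25 := by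
        rw [div_le_div_iff₀ (by positivity) (by norm_num)]
        nlinarith
      calc ((p:ℝ) - 1) * (Real.sqrt 3 * (4 / (p:ℝ) ^ 2)) = Real.sqrt 3 * 4 * (((p:ℝ) - 1) / p ^ 2) := by ring
        _ ≤ 1.7321 * 4 * (4/25) := by
            apply mul_le_mul (by linarith) this (by apply div_nonneg; linarith; positivity) (by norm_num)
        _ ≤ _ := by norm_num
    refine e1.trans ((Real.exp_le_exp.2 e2).trans ?_)
    rw [Real.exp_add]
    have a1 := Real.exp_one_lt_d9
    have a2 := exp_le_inv 0.11 (by norm_num)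
    calc Real.exp 1 * Real.exp 0.11 ≤ 2.7182818286 * (1 / (1 - 0.11)) := by
          apply mul_le_mul a1.le a2 (Real.exp_pos _).le (by norm_num)
      _ ≤ _ := by norm_num

section
variable {n p : ℕ} (X : Matrix (Fin n) (Fin p) ℝ)

lemma over_sum (τ₀ : Finset (Fin p)) (hk : 1 ≤ τ₀.card) (m : Fin n → ℝ) (hm : tl m ∈ Sp X τ₀)
    (σ lam t : ℝ) (hσ : 0 < σ) (ht : 0 < t)
    (hlam : 6 * σ ^ 2 * ((τ₀.card:ℝ) + 1) * Real.log ((p:ℝ) / 2) + n * t ≤ lam)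
    (ustar : Fin n → ℝ) :
    stdGaussian n {u | ∃ τ : Finset (Fin p), τ₀.card < τ.card ∧
      objPen X lam (m + σ • u) ustar τ ≤ objPen X lam (m + σ • u) ustar τ₀} ≤
    ENNReal.ofReal (2.25 * Real.exp (-(n * t / (3 * σ ^ 2)))) := by
  rcases lt_or_ge p 2 with hp | hp
  · have : {u | ∃ τ : Finset (Fin p), τ₀.card < τ.card ∧
      objPen X lam (m + σ • u) ustar τ ≤ objPen X lam (m + σ • u) ustar τ₀} = ∅ := by
      ext u
      simp only [Set.mem_ofPred_eq, Set.mem_empty_iff_false, iff_false]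
      rintro ⟨τ, h, -⟩
      have := τ.card_le_univ
      simp at this
      omega
    rw [this]; simp
  have hp' : (2:ℝ) ≤ p := by exact_mod_cast hp
  have hL : 0 ≤ Real.log ((p:ℝ)/2) := Real.log_nonneg (by linarith)
  have hlam0 : 0 ≤ lam := le_trans (by positivity) hlam
  set E := Real.exp (-(n * t / (3 * σ ^ 2))) with hE
  set x : ℝ := Real.sqrt 3 * (4 / (p:ℝ)^2) with hx
  have hx0 : 0 ≤ x := by positivity
  refine measure_union_real _ ((τ₀ᶜ).powerset.erase ∅) _
    (fun A => {u | lam * (max 1 (A.card - τ₀.card) : ℕ) ≤ σ^2 * ‖(Wsub X τ₀ A ustar).starProjection (tl u)‖^2})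
    (fun A => x ^ A.card * E) (fun A _ => by positivity) ?_ ?_ _ ?_
  · rintro u ⟨τ, h1, h2⟩
    have hc := Finset.card_sdiff_add_card_inter τ τ₀
    have hc2 : (τ ∩ τ₀).card ≤ τ₀.card := Finset.card_le_card Finset.inter_subset_right
    simp only [Set.mem_iUnion]
    refine ⟨τ \ τ₀, ?_, ?_⟩
    · simp only [Finset.mem_erase, Finset.mem_powerset]
      refine ⟨?_, ?_⟩
      · rw [← Finset.card_pos.trans Finset.nonempty_iff_ne_empty]; omega
      · intro j hj; simp at hj ⊢; exact hj.2
    · have := over_red X τ₀ τ m hm σ lam u ustar h2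
      refine le_trans (mul_le_mul_of_nonneg_left ?_ hlam0) this
      have : max 1 ((τ \ τ₀).card - τ₀.card) + τ₀.card ≤ τ.card := by omega
      have h := (Nat.cast_le (α := ℝ)).2 this
      push_cast at h ⊢
      linarith
  · intro A hA
    simp only [Finset.mem_erase, Finset.mem_powerset] at hA
    refine (over_chern X τ₀ A hA.2 σ _ hσ ustar).trans (ENNReal.ofReal_le_ofReal ?_)
    rw [hx, mul_pow, mul_assoc]
    apply mul_le_mul_of_nonneg_left _ (by positivity)
    have hA1 : 1 ≤ A.card := Finset.card_pos.2 (Finset.nonempty_iff_ne_empty.2 hA.1)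
    have e : (4 / (p:ℝ)^2) ^ A.card = Real.exp (-(2 * A.card * Real.log ((p:ℝ)/2))) := by
      have : (4 / (p:ℝ)^2) = Real.exp (-(2 * Real.log ((p:ℝ)/2))) := by
        rw [Real.exp_neg, two_mul, Real.exp_add, Real.exp_log (by positivity)]
        field_simp; norm_num
      rw [this, ← Real.exp_nat_mul]; congr 1; ring
    rw [e, hE, ← Real.exp_add]
    apply Real.exp_le_exp.2
    set j : ℕ := max 1 (A.card - τ₀.card) with hj
    have hj1 : 1 ≤ j := le_max_left _ _
    have hjk : A.card ≤ (τ₀.card + 1) * j := by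
      rcases le_or_gt A.card (τ₀.card + 1) with h | h
      · exact h.trans (Nat.le_mul_of_pos_right _ hj1)
      · have : j = A.card - τ₀.card := by omega
        obtain ⟨c, hc⟩ : ∃ c, A.card = τ₀.card + 1 + c := ⟨A.card - (τ₀.card+1), by omega⟩
        have : j = 1 + c := by omega
        rw [this, hc]; nlinarith
    have hj1' : (1:ℝ) ≤ j := by exact_mod_cast hj1
    have hjk' : (A.card:ℝ) ≤ (τ₀.card + 1) * j := by exact_mod_cast hjk
    have h1 : (6 * σ ^ 2 * ((τ₀.card:ℝ) + 1) * Real.log ((p:ℝ) / 2) + n * t) * j ≤ lam * j :=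
      mul_le_mul_of_nonneg_right hlam (by positivity)
    have h2 : 2 * A.card * Real.log ((p:ℝ)/2) + n * t / (3*σ^2) ≤ lam * j / (3 * σ^2) := by
      rw [le_div_iff₀ (by positivity), add_mul, div_mul_cancel₀ _ (by positivity)]
      have h3 : (A.card:ℝ) * (6 * σ^2 * Real.log ((p:ℝ)/2)) ≤ (τ₀.card + 1) * j * (6 * σ^2 * Real.log ((p:ℝ)/2)) :=
        mul_le_mul_of_nonneg_right hjk' (by positivity)
      have h4 : n * t * 1 ≤ n * t * j := mul_le_mul_of_nonneg_left hj1' (by positivity)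
      nlinarith
    linarith
  · rw [← Finset.sum_mul, sum_pow_card_ne]
    apply mul_le_mul_of_nonneg_right _ (Real.exp_pos _).le
    have hcard : (τ₀ᶜ).card ≤ p - 1 := by
      rw [Finset.card_compl]; simp; omega
    have := pow_le_pow_right₀ (by linarith : (1:ℝ) ≤ 1 + x) hcard
    have := over_num p hp
    linarith
end

end

section


lemma exp_le_inv_pow (x : ℝ) (h : x < 10) : Real.exp x ≤ (1 / (1 - x / 10)) ^ 10 := by
  have : Real.exp x = Real.exp (x/10) ^ 10 := by rw [← Real.exp_nat_mul]; congr 1; push_cast; ring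
  rw [this]
  exact pow_le_pow_left₀ (Real.exp_pos _).le (exp_le_inv _ (by linarith)) _

lemma one_add_pow_le_exp (x : ℝ) (hx : 0 ≤ x) (k : ℕ) : (1 + x) ^ k ≤ Real.exp (k * x) := by
  rw [Real.exp_nat_mul]
  apply pow_le_pow_left₀ (by positivity)
  have := Real.add_one_le_exp x; linarith

lemma cap_num (n : ℕ) (hn : 9 ≤ n) :
    2 * Real.sqrt (11/4) * (1 / Real.sqrt (11/4)) ^ n * Real.exp (Real.sqrt (11/4)) ≤
      Real.exp 2 / 4 * Real.exp (-(0.23 * n)) := by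
  set w := Real.sqrt (11/4) with hw
  have w1 : w < 1.6584 := by rw [hw, Real.sqrt_lt' (by norm_num)]; norm_num
  have w2 : 1.658 < w := by rw [hw]; apply Real.lt_sqrt_of_sq_lt; norm_num
  have hw0 : 0 < w := by linarith
  have q1 : 1 / w ≤ 1 / 1.658 := one_div_le_one_div_of_le (by norm_num) w2.le
  have e23 : Real.exp 0.23 ≤ 1.2621 := (exp_le_inv_pow 0.23 (by norm_num)).trans (by norm_num)
  have hr : 1 / w * Real.exp 0.23 ≤ 0.76123 := by
    calc 1 / w * Real.exp 0.23 ≤ 1 / 1.658 * 1.2621 := by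
          apply mul_le_mul q1 e23 (Real.exp_pos _).le (by norm_num)
      _ ≤ _ := by norm_num
  have hr0 : 0 ≤ 1 / w * Real.exp 0.23 := by positivity
  have hrn : (1 / w * Real.exp 0.23) ^ n ≤ 0.0859 := by
    calc (1 / w * Real.exp 0.23) ^ n ≤ (1 / w * Real.exp 0.23) ^ 9 :=
          pow_le_pow_of_le_one hr0 (by linarith) hn
      _ ≤ 0.76123 ^ 9 := pow_le_pow_left₀ hr0 hr _
      _ ≤ _ := by norm_num
  have ew : Real.exp w ≤ 5.4 := by
    have a1 := Real.exp_one_lt_d9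
    have : Real.exp w ≤ Real.exp (1 + 0.6584) := Real.exp_le_exp.2 (by linarith)
    rw [Real.exp_add] at this
    have a2 := exp_le_inv_pow 0.6584 (by norm_num)
    have a3 : Real.exp 0.6584 ≤ 1.98 := a2.trans (by norm_num)
    calc _ ≤ _ := this
      _ ≤ 2.7182818286 * 1.98 := mul_le_mul a1.le a3 (Real.exp_pos _).le (by norm_num)
      _ ≤ _ := by norm_num
  have e2 : 1.8 ≤ Real.exp 2 / 4 := by
    have : Real.exp 2 = Real.exp 1 ^ 2 := by rw [← Real.exp_nat_mul]; norm_num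
    rw [this]
    have := Real.exp_one_gt_d9
    nlinarith
  have hn' : Real.exp (-(0.23 * n)) = (Real.exp 0.23 ^ n)⁻¹ := by
    rw [Real.exp_neg, ← Real.exp_nat_mul]; congr 2; ring
  rw [hn', ← div_eq_mul_inv, le_div_iff₀ (by positivity)]
  calc 2 * w * (1 / w) ^ n * Real.exp w * Real.exp 0.23 ^ n
      = 2 * w * Real.exp w * (1 / w * Real.exp 0.23) ^ n := by rw [mul_pow]; ring
    _ ≤ 2 * 1.6584 * 5.4 * 0.0859 := by gcongr
    _ ≤ 1.8 := by norm_num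
    _ ≤ _ := e2

lemma under_num (p k c : ℕ) (hp : 1 ≤ p) (hk : k ≤ p) (hc : c ≤ p) (y : ℝ) (hy0 : 0 ≤ y)
    (hy : y * ((p:ℝ) + 1) ^ 6 ≤ 1) :
    (1 + 1 / Real.sqrt (3/4) / p) ^ c * ((1 + p * y) ^ k - 1) ≤ 4.5 * ((p:ℝ)+1)^2 * y := by
  have hp' : (1:ℝ) ≤ p := by exact_mod_cast hp
  have hk' : (k:ℝ) ≤ p := by exact_mod_cast hk
  have hc' : (c:ℝ) ≤ p := by exact_mod_cast hc
  have hs : 0.866 < Real.sqrt (3/4) := by apply Real.lt_sqrt_of_sq_lt; norm_num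
  set b := 1 / Real.sqrt (3/4) with hb
  have hb0 : 0 ≤ b := by positivity
  have hb1 : b ≤ 1.16 := by
    rw [hb, div_le_iff₀ (by linarith)]; linarith
  have h1 : (1 + b / p) ^ c ≤ 3.24 := by
    refine (one_add_pow_le_exp _ (by positivity) c).trans ?_
    have : (c:ℝ) * (b / p) ≤ 1 + 0.16 := by
      calc (c:ℝ) * (b / p) ≤ p * (b / p) := by gcongr
        _ = b := by field_simp
        _ ≤ _ := by linarith
    refine (Real.exp_le_exp.2 this).trans ?_
    rw [Real.exp_add]
    have a1 := Real.exp_one_lt_d9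
    have a2 := exp_le_inv 0.16 (by norm_num)
    calc Real.exp 1 * Real.exp 0.16 ≤ 2.7182818286 * (1 / (1 - 0.16)) := by
          apply mul_le_mul a1.le a2 (Real.exp_pos _).le (by norm_num)
      _ ≤ _ := by norm_num
  set z := (p:ℝ) ^ 2 * y with hz
  have hz0 : 0 ≤ z := by positivity
  have hz1 : z ≤ 1 / 16 := by
    have a : (16:ℝ) * p ^ 2 ≤ (p + 1) ^ 6 := by
      have : (p:ℝ)^2 ≤ (p+1)^2 := by gcongr; linarith
      have h2 : (16:ℝ) ≤ (p+1)^4 := by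
        calc (16:ℝ) = (1+1)^4 := by norm_num
          _ ≤ _ := by gcongr
      calc (16:ℝ) * p^2 ≤ (p+1)^4 * (p+1)^2 := by gcongr
        _ = _ := by ring
    have := mul_le_mul_of_nonneg_left a hy0
    rw [hz]; linarith
  have h2 : (1 + p * y) ^ k - 1 ≤ 16/15 * z := by
    have a := one_add_pow_le_exp (p * y) (by positivity) k
    have b' : (k:ℝ) * (p * y) ≤ z := by
      rw [hz]
      calc (k:ℝ) * (p * y) ≤ p * (p * y) := by gcongr
        _ = _ := by ring
    have c1 := Real.exp_le_exp.2 b'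
    have d1 := exp_le_inv z (by linarith)
    have : 1 / (1 - z) ≤ 1 + 16/15 * z := by
      rw [div_le_iff₀ (by linarith)]; nlinarith
    linarith
  have h20 : 0 ≤ (1 + p * y) ^ k - 1 := by
    have := one_le_pow₀ (M₀ := ℝ) (a := 1 + p * y) (n := k) (by nlinarith)
    linarith
  calc _ ≤ 3.24 * (16/15 * z) := mul_le_mul h1 h2 h20 (by norm_num)
    _ ≤ 4.5 * ((p:ℝ)^2 * y) := by rw [← hz]; linarith
    _ ≤ 4.5 * ((p+1)^2 * y) := by gcongr; linarith
    _ = _ := by ring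

section
variable {n p : ℕ} (X : Matrix (Fin n) (Fin p) ℝ)

def badU (τ₀ : Finset (Fin p)) (m : Fin n → ℝ) : Set (Fin n → ℝ) :=
  {u | ∃ τ : Finset (Fin p), (τ ≠ τ₀ ∧ τ.card ≤ τ₀.card) ∧
    0.7 * ‖(Sp X τ)ᗮ.starProjection (tl m)‖^2 * ‖(Sp X τ)ᗮ.starProjection (tl u)‖^2 <
      (inner ℝ ((Sp X τ)ᗮ.starProjection (tl m)) (tl u))^2}

lemma under_sum (τ₀ : Finset (Fin p)) (hk : 1 ≤ τ₀.card) (m : Fin n → ℝ) (hm : tl m ∈ Sp X τ₀)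
    (σ lam C : ℝ) (hσ : 0 < σ) (hC : 0 < C)
    (hsep : ∀ τ : Finset (Fin p), τ ≠ τ₀ → τ.card ≤ τ₀.card →
      C * (n * (τ₀ \ τ).card) ≤ ‖(Sp X τ)ᗮ.starProjection (tl m)‖^2)
    (hlam : lam ≤ 0.05 * (n * C))
    (hy : Real.exp (-(n * C / σ^2 / 60)) * ((p:ℝ) + 1) ^ 6 ≤ 1)
    (ustar : Fin n → ℝ) (hu : ustar ∉ badU X τ₀ m) :
    stdGaussian n {u | ∃ τ : Finset (Fin p), (τ ≠ τ₀ ∧ τ.card ≤ τ₀.card) ∧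
      objPen X lam (m + σ • u) ustar τ ≤ objPen X lam (m + σ • u) ustar τ₀} ≤
    ENNReal.ofReal (4.5 * ((p:ℝ)+1)^2 * Real.exp (-(n * C / σ^2 / 60))) := by
  have hkp : τ₀.card ≤ p := by simpa using τ₀.card_le_univ
  have hp : 1 ≤ p := by omega
  have hp' : (1:ℝ) ≤ p := by exact_mod_cast hp
  set y := Real.exp (-(n * C / σ^2 / 60)) with hydef
  have hy0 : 0 ≤ y := (Real.exp_pos _).le
  set b := 1 / Real.sqrt (3/4) with hb
  have hb0 : 0 ≤ b := by positivity
  refine measure_union_real _ ((τ₀.powerset.erase ∅) ×ˢ (τ₀ᶜ).powerset) _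
    (fun i => {u | i.2.card ≤ i.1.card ∧ objPen X lam (m + σ • u) ustar ((τ₀ \ i.1) ∪ i.2)
      ≤ objPen X lam (m + σ • u) ustar τ₀})
    (fun i => (p * y) ^ i.1.card * (b / p) ^ i.2.card) (fun A _ => by positivity) ?_ ?_ _ ?_
  · rintro u ⟨τ, ⟨h1, h2⟩, h3⟩
    have hc := Finset.card_sdiff_add_card_inter τ τ₀
    have hc2 := Finset.card_sdiff_add_card_inter τ₀ τ
    rw [Finset.inter_comm] at hc2
    simp only [Set.mem_iUnion]
    refine ⟨(τ₀ \ τ, τ \ τ₀), ?_, ?_, ?_⟩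
    · simp only [Finset.mem_product, Finset.mem_erase, Finset.mem_powerset]
      refine ⟨⟨?_, Finset.sdiff_subset⟩, ?_⟩
      · intro h
        rw [Finset.sdiff_eq_empty_iff_subset] at h
        exact h1 (Finset.eq_of_subset_of_card_le h h2).symm
      · intro j hj; simp at hj ⊢; exact hj.2
    · simp only; omega
    · have : (τ₀ \ (τ₀ \ τ)) ∪ (τ \ τ₀) = τ := by ext j; simp; tauto
      simp only [this]; exact h3
  · rintro ⟨B, A⟩ hBA
    simp only [Finset.mem_product, Finset.mem_erase, Finset.mem_powerset] at hBA
    obtain ⟨⟨hB0, hB⟩, hA⟩ := hBA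
    by_cases hcard : A.card ≤ B.card
    swap
    · simp [hcard]
    simp only [hcard, true_and]
    set τ := (τ₀ \ B) ∪ A with hτ
    have hd1 : τ₀ \ τ = B := by
      ext j; simp only [hτ, Finset.mem_sdiff, Finset.mem_union]
      constructor
      · rintro ⟨h1, h2⟩; by_contra h; exact h2 (Or.inl ⟨h1, h⟩)
      · intro h; refine ⟨hB h, ?_⟩
        rintro (h2 | h2)
        · exact h2.2 h
        · have := hA h2; simp at this; exact this (hB h)
    have hd2 : τ \ τ₀ = A := by
      ext j; simp only [hτ, Finset.mem_sdiff, Finset.mem_union]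
      constructor
      · rintro ⟨h1 | h1, h2⟩
        · exact absurd h1.1 h2
        · exact h1
      · intro h; have := hA h; simp at this; exact ⟨Or.inr h, this⟩
    have hc := Finset.card_sdiff_add_card_inter τ τ₀
    have hc2 := Finset.card_sdiff_add_card_inter τ₀ τ
    rw [Finset.inter_comm, hd1] at hc2
    rw [hd2] at hc
    have hne : τ ≠ τ₀ := by
      intro h; rw [h] at hd1; simp at hd1; exact hB0 hd1.symm
    have hle : τ.card ≤ τ₀.card := by omega
    have hs := hsep τ hne hle
    rw [hd1] at hs
    have hgood : (inner ℝ ((Sp X τ)ᗮ.starProjection (tl m)) (tl ustar))^2 ≤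
        0.7 * ‖(Sp X τ)ᗮ.starProjection (tl m)‖^2 * ‖(Sp X τ)ᗮ.starProjection (tl ustar)‖^2 := by
      by_contra h; push Not at h; exact hu ⟨τ, ⟨hne, hle⟩, h⟩
    have hq := Q_rank_one X τ m ustar hgood
    have hN : (B.card * (n * C / σ^2)) * σ^2 = C * (n * B.card) := by field_simp
    refine (under_chern X τ₀ τ m hm σ lam (B.card * (n * C / σ^2)) hσ (by positivity) ustar
      ?_ ?_).trans (ENNReal.ofReal_le_ofReal ?_)
    · rw [hN]; linarith
    · rw [hN]
      have h1 : (τ₀.card:ℝ) - τ.card = B.card - A.card := by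
        have : τ₀.card + A.card = τ.card + B.card := by omega
        have h := congrArg (Nat.cast (R := ℝ)) this
        push_cast at h; linarith
      have h2 : (0:ℝ) ≤ (B.card:ℝ) - A.card := by
        have : (A.card:ℝ) ≤ B.card := by exact_mod_cast hcard
        linarith
      rw [h1]
      have h3 := mul_le_mul_of_nonneg_right hlam h2
      have h4 : 0 ≤ 0.05 * (n * C) * A.card := by positivity
      nlinarith
    · rw [hd2, ← hb]
      have e : Real.exp (-((B.card:ℝ) * (n * C / σ^2) / 60)) = y ^ B.card := by
        rw [hydef, ← Real.exp_nat_mul]; congr 1; ring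
      rw [e, mul_pow, div_pow b]
      have hpp : (p:ℝ)^A.card ≤ p ^ B.card := pow_le_pow_right₀ hp' hcard
      calc b ^ A.card * y ^ B.card = (p:ℝ)^A.card * y ^ B.card * (b ^ A.card / (p:ℝ) ^ A.card) := by
            field_simp
        _ ≤ _ := by gcongr
  · rw [Finset.sum_product]
    dsimp only
    rw [← Finset.sum_mul_sum, sum_pow_card_ne, sum_pow_card, mul_comm]
    refine under_num p _ _ hp hkp ?_ y hy0 hy
    simpa using (τ₀ᶜ).card_le_univ

lemma cap_sum (τ₀ : Finset (Fin p)) (hk : 1 ≤ τ₀.card) (hkn : τ₀.card < n) (hn : 9 ≤ n)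
    (m : Fin n → ℝ)
    (hsep : ∀ τ : Finset (Fin p), τ ≠ τ₀ → τ.card ≤ τ₀.card →
      0 < ‖(Sp X τ)ᗮ.starProjection (tl m)‖^2) :
    stdGaussian n (badU X τ₀ m) ≤
      ENNReal.ofReal (Real.exp 2 / 4 * p ^ τ₀.card * Real.exp (-(0.23 * n))) := by
  have hkp : τ₀.card ≤ p := by simpa using τ₀.card_le_univ
  have hp : 1 ≤ p := by omega
  have hp' : (1:ℝ) ≤ p := by exact_mod_cast hp
  set w := Real.sqrt (11/4) with hw
  have hw0 : 0 < w := by positivity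
  refine measure_union_real _ (Finset.univ.filter (fun τ : Finset (Fin p) => τ ≠ τ₀ ∧ τ.card ≤ τ₀.card)) _
    (fun τ => {u | 0.7 * ‖(Sp X τ)ᗮ.starProjection (tl m)‖^2 * ‖(Sp X τ)ᗮ.starProjection (tl u)‖^2 <
      (inner ℝ ((Sp X τ)ᗮ.starProjection (tl m)) (tl u))^2})
    (fun τ => 2 * w * (1/w)^n * p^τ₀.card * (w/p)^τ.card) (fun A _ => by positivity) ?_ ?_ _ ?_
  · rintro u ⟨τ, h1, h2⟩
    simp only [Set.mem_iUnion]
    exact ⟨τ, by simpa using h1, h2⟩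
  · intro τ hτ
    simp only [Finset.mem_filter, Finset.mem_univ, true_and] at hτ
    have h0 := hsep τ hτ.1 hτ.2
    have hfr := finrank_Sp_orth X τ
    refine (cap ((Sp X τ)ᗮ) ((Sp X τ)ᗮ.starProjection (tl m)) (Submodule.starProjection_apply_mem _ _)
      ?_ (n - τ.card - 1) ?_).trans (ENNReal.ofReal_le_ofReal ?_)
    · intro h; rw [h] at h0; simp at h0
    · omega
    · rw [← hw]
      obtain ⟨c, hc⟩ : ∃ c, n = c + τ.card + 1 := ⟨n - τ.card - 1, by omega⟩
      have h1 : n - τ.card - 1 = c := by omega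
      rw [h1]
      have e : (1/w)^c = w * (1/w)^n * w ^ τ.card := by
        rw [hc, pow_succ, pow_add, _root_.one_div_pow, _root_.one_div_pow]; field_simp
      rw [e, div_pow w]
      have hpp : (p:ℝ)^τ.card ≤ p ^ τ₀.card := pow_le_pow_right₀ hp' hτ.2
      calc 2 * (w * (1/w)^n * w ^ τ.card) = 2 * w * (1/w)^n * p^τ.card * (w^τ.card / p^τ.card) := by
            field_simp
        _ ≤ _ := by gcongr
  · rw [← Finset.mul_sum]
    have h1 : ∑ τ ∈ Finset.univ.filter (fun τ : Finset (Fin p) => τ ≠ τ₀ ∧ τ.card ≤ τ₀.card), (w/p)^τ.card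
        ≤ Real.exp w := by
      calc _ ≤ ∑ τ ∈ (Finset.univ : Finset (Fin p)).powerset, (w/p)^τ.card := by
            apply Finset.sum_le_sum_of_subset_of_nonneg
            · intro τ _; simp
            · intros; positivity
        _ = (1 + w/p)^p := by rw [sum_pow_card]; simp
        _ ≤ Real.exp (p * (w/p)) := one_add_pow_le_exp _ (by positivity) _
        _ = Real.exp w := by congr 1; field_simp
    have h2 := cap_num n hn
    rw [← hw] at h2
    calc _ ≤ 2 * w * (1/w)^n * p^τ₀.card * Real.exp w := by gcongr
      _ = (2 * w * (1/w)^n * Real.exp w) * p^τ₀.card := by ring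
      _ ≤ (Real.exp 2 / 4 * Real.exp (-(0.23 * n))) * p^τ₀.card := by gcongr
      _ = _ := by ring
end

end

section


lemma real_pow_split (g g2 c : ℝ) (hg0 : 0 ≤ g) (hg1 : g ≤ 1) (hg2 : 0 ≤ g2) (hc : 0 ≤ c)
    (h : g ≤ g2 + c) (d : ℕ) (hd : 1 ≤ d) : g ^ d ≤ 4/3 * g2 + (4 * c) ^ d := by
  rcases le_or_gt (3/4 * g) g2 with h1 | h1
  · have : g ^ d ≤ g := pow_le_of_le_one hg0 hg1 (by omega)
    have : 0 ≤ (4 * c) ^ d := by positivity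
    linarith
  · have h2 : g ≤ 4 * c := by linarith
    have := pow_le_pow_left₀ hg0 h2 d
    linarith

lemma prod_fail {E : Type*} [MeasurableSpace E] (γ : Measure E) [IsProbabilityMeasure γ]
    (F : Set (E × E)) (hF : MeasurableSet F) (G : Set E) (hG : MeasurableSet G) (a c : ℝ)
    (ha : 0 ≤ a) (hc : 0 ≤ c) (h1 : ∀ v ∉ G, γ {u | (u, v) ∈ F} ≤ ENNReal.ofReal a)
    (h2 : γ G ≤ ENNReal.ofReal c) (d : ℕ) (hd : 1 ≤ d) :
    (γ.prod (Measure.pi fun _ : Fin d => γ)) {ω | ∀ b, (ω.1, ω.2 b) ∈ F} ≤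
      ENNReal.ofReal (4/3 * a + (4 * c) ^ d) := by
  have hm : MeasurableSet {ω : E × (Fin d → E) | ∀ b, (ω.1, ω.2 b) ∈ F} := by
    rw [Set.ofPred_forall]
    refine MeasurableSet.iInter fun b => ?_
    exact (measurable_fst.prodMk ((measurable_pi_apply b).comp measurable_snd)) hF
  rw [Measure.prod_apply hm]
  set F2 : Set (E × E) := F \ (Prod.snd ⁻¹' G) with hF2
  have hF2m : MeasurableSet F2 := hF.diff (measurable_snd hG)
  have e1 : ∀ u, (Measure.pi fun _ : Fin d => γ) (Prod.mk u ⁻¹' {ω : E × (Fin d → E) | ∀ b, (ω.1, ω.2 b) ∈ F})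
      = γ (Prod.mk u ⁻¹' F) ^ d := by
    intro u
    have : (Prod.mk u ⁻¹' {ω : E × (Fin d → E) | ∀ b, (ω.1, ω.2 b) ∈ F}) =
        Set.univ.pi (fun _ => Prod.mk u ⁻¹' F) := by
      ext v; simp
    rw [this, Measure.pi_pi]; simp
  simp_rw [e1]
  have e2 : ∀ u, γ (Prod.mk u ⁻¹' F) ^ d ≤ ENNReal.ofReal (4/3) * γ (Prod.mk u ⁻¹' F2) +
      ENNReal.ofReal ((4 * c) ^ d) := by
    intro u
    have h3 : γ (Prod.mk u ⁻¹' F) ≤ γ (Prod.mk u ⁻¹' F2) + ENNReal.ofReal c := by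
      refine le_trans (measure_mono ?_) ((measure_union_le (Prod.mk u ⁻¹' F2) G).trans (by gcongr))
      intro v hv
      by_cases hvG : v ∈ G
      · exact Or.inr hvG
      · exact Or.inl ⟨hv, hvG⟩
    have f1 : γ (Prod.mk u ⁻¹' F) ≠ ∞ := measure_ne_top _ _
    have f2 : γ (Prod.mk u ⁻¹' F2) ≠ ∞ := measure_ne_top _ _
    rw [← ENNReal.ofReal_toReal f1, ← ENNReal.ofReal_toReal f2]
    rw [← ENNReal.ofReal_toReal f1, ← ENNReal.ofReal_toReal f2, ← ENNReal.ofReal_add (by positivity) hc,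
      ENNReal.ofReal_le_ofReal_iff (by positivity)] at h3
    rw [← ENNReal.ofReal_pow (by positivity), ← ENNReal.ofReal_mul (by positivity),
      ← ENNReal.ofReal_add (by positivity) (by positivity)]
    apply ENNReal.ofReal_le_ofReal
    apply real_pow_split _ _ _ (by positivity) _ (by positivity) hc h3 d hd
    have := ENNReal.toReal_mono ENNReal.one_ne_top (prob_le_one (μ := γ) (s := Prod.mk u ⁻¹' F))
    simpa using this
  have e3 : ∫⁻ u, γ (Prod.mk u ⁻¹' F2) ∂γ ≤ ENNReal.ofReal a := by
    rw [← Measure.prod_apply hF2m, Measure.prod_apply_symm hF2m]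
    calc _ ≤ ∫⁻ _, ENNReal.ofReal a ∂γ := by
          apply lintegral_mono
          intro v
          by_cases hv : v ∈ G
          · have : (fun x => (x, v)) ⁻¹' F2 = ∅ := by ext x; simp [hF2, hv]
            simp only [this, measure_empty]; exact zero_le
          · refine le_trans (measure_mono ?_) (h1 v hv)
            intro x hx; exact hx.1
      _ = _ := by simp
  calc _ ≤ ∫⁻ u, (ENNReal.ofReal (4/3) * γ (Prod.mk u ⁻¹' F2) + ENNReal.ofReal ((4 * c) ^ d)) ∂γ :=
        lintegral_mono e2
    _ = ENNReal.ofReal (4/3) * ∫⁻ u, γ (Prod.mk u ⁻¹' F2) ∂γ + ENNReal.ofReal ((4 * c) ^ d) := by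
        rw [lintegral_add_right _ measurable_const,
          lintegral_const_mul _ (measurable_measure_prodMk_left hF2m)]; simp
    _ ≤ ENNReal.ofReal (4/3) * ENNReal.ofReal a + ENNReal.ofReal ((4 * c) ^ d) := by gcongr
    _ = _ := by
        rw [← ENNReal.ofReal_mul (by norm_num), ← ENNReal.ofReal_add (by positivity) (by positivity)]

instance (n : ℕ) : IsProbabilityMeasure (stdGaussian n) := by
  unfold stdGaussian; infer_instance

section
variable {n p : ℕ} (X : Matrix (Fin n) (Fin p) ℝ)

lemma badU_meas (τ₀ : Finset (Fin p)) (m : Fin n → ℝ) : MeasurableSet (badU X τ₀ m) := by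
  unfold badU
  rw [Set.ofPred_exists]
  refine MeasurableSet.iUnion fun τ => ?_
  rw [Set.ofPred_and]
  refine (MeasurableSet.const _).inter ?_
  have := measurable_tl (n := n)
  apply measurableSet_lt
  · fun_prop
  · fun_prop

lemma fail_prob (τ₀ : Finset (Fin p)) (hk : 1 ≤ τ₀.card) (hkn : τ₀.card < n) (hn : 9 ≤ n)
    (m : Fin n → ℝ) (hm : tl m ∈ Sp X τ₀)
    (σ lam C t : ℝ) (hσ : 0 < σ) (hC : 0 < C) (ht : 0 < t)
    (hsep : ∀ τ : Finset (Fin p), τ ≠ τ₀ → τ.card ≤ τ₀.card →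
      C * (n * (τ₀ \ τ).card) ≤ ‖(Sp X τ)ᗮ.starProjection (tl m)‖^2)
    (hlam1 : 6 * σ ^ 2 * ((τ₀.card:ℝ) + 1) * Real.log ((p:ℝ) / 2) + n * t ≤ lam)
    (hlam : lam ≤ 0.05 * (n * C))
    (hy : Real.exp (-(n * C / σ^2 / 60)) * ((p:ℝ) + 1) ^ 6 ≤ 1)
    (d : ℕ) (hd : 1 ≤ d) :
    jointMeasure n d {ω | ∀ b, ∃ τ : Finset (Fin p), τ ≠ τ₀ ∧
      objPen X lam (m + σ • ω.1) (ω.2 b) τ ≤ objPen X lam (m + σ • ω.1) (ω.2 b) τ₀} ≤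
    ENNReal.ofReal (6 * (((p:ℝ)+1)^2 * Real.exp (-(n * C / σ^2 / 60))) +
      3 * Real.exp (-(n * t / (3 * σ^2))) + (Real.exp 2 * p ^ τ₀.card * Real.exp (-(0.23 * n))) ^ d) := by
  set F : Set ((Fin n → ℝ) × (Fin n → ℝ)) := {z | ∃ τ : Finset (Fin p), τ ≠ τ₀ ∧
      objPen X lam (m + σ • z.1) z.2 τ ≤ objPen X lam (m + σ • z.1) z.2 τ₀} with hFdef
  have hF : MeasurableSet F := by
    rw [hFdef, Set.ofPred_exists]
    refine MeasurableSet.iUnion fun τ => ?_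
    rw [Set.ofPred_and]
    refine (MeasurableSet.const _).inter ?_
    have hmap : Measurable (fun z : (Fin n → ℝ) × (Fin n → ℝ) => (m + σ • z.1, z.2)) := by fun_prop
    have key : ∀ τ', Measurable (fun z : (Fin n → ℝ) × (Fin n → ℝ) => objPen X lam (m + σ • z.1) z.2 τ') := by
      intro τ'
      have h := (objPen_meas X lam τ').comp hmap
      simp only [Function.comp_def] at h
      exact h
    exact measurableSet_le (key τ) (key τ₀)
  have hn0 : (0:ℝ) < n := by exact_mod_cast (by omega : 0 < n)
  refine (prod_fail (stdGaussian n) F hF (badU X τ₀ m) (badU_meas X τ₀ m)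
    (4.5 * ((p:ℝ)+1)^2 * Real.exp (-(n * C / σ^2 / 60)) + 2.25 * Real.exp (-(n * t / (3 * σ^2))))
    (Real.exp 2 / 4 * p ^ τ₀.card * Real.exp (-(0.23 * n))) (by positivity) (by positivity) ?_ ?_ d hd).trans
      (ENNReal.ofReal_le_ofReal (le_of_eq ?_))
  · intro v hv
    rw [ENNReal.ofReal_add (by positivity) (by positivity)]
    refine le_trans (measure_mono ?_) ((measure_union_le _ _).trans (add_le_add
      (under_sum X τ₀ hk m hm σ lam C hσ hC hsep hlam hy v hv)
      (over_sum X τ₀ hk m hm σ lam t hσ ht hlam1 v)))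
    rintro u ⟨τ, h1, h2⟩
    rcases le_or_gt τ.card τ₀.card with h | h
    · exact Or.inl ⟨τ, ⟨h1, h⟩, h2⟩
    · exact Or.inr ⟨τ, h, h2⟩
  · refine cap_sum X τ₀ hk hkn hn m ?_
    intro τ h1 h2
    refine lt_of_lt_of_le ?_ (hsep τ h1 h2)
    have : 0 < (τ₀ \ τ).card := by
      rw [Finset.card_pos, Finset.sdiff_nonempty]
      intro h
      exact h1 (Finset.eq_of_subset_of_card_le h h2).symm
    positivity
  · rw [show 4 * (Real.exp 2 / 4 * (p:ℝ) ^ τ₀.card * Real.exp (-(0.23 * n))) =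
      Real.exp 2 * p ^ τ₀.card * Real.exp (-(0.23 * n)) by ring]
    ring
end

end

section


lemma quad_shift {n : ℕ} (A : Matrix (Fin n) (Fin n) ℝ) (hA : Aᵀ = A) (r u : Fin n → ℝ) (σ : ℝ)
    (h : A.mulVec r = 0) :
    (r + σ • u) ⬝ᵥ A.mulVec (r + σ • u) = σ ^ 2 * (u ⬝ᵥ A.mulVec u) := by
  have h2 : r ⬝ᵥ A.mulVec u = 0 := by
    rw [Matrix.dotProduct_mulVec, ← Matrix.mulVec_transpose, hA, h, zero_dotProduct]
  rw [Matrix.mulVec_add, h, zero_add, Matrix.mulVec_smul, add_dotProduct, dotProduct_smul, h2,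
    smul_dotProduct, dotProduct_smul]
  simp; ring

lemma projMat_nonneg {n : ℕ} {m : Type} [Fintype m] [DecidableEq m]
    (M : Matrix (Fin n) m ℝ) (u : Fin n → ℝ) : 0 ≤ u ⬝ᵥ (projMat M).mulVec u := by
  have h1 : ((Mᵀ * M)⁻¹).PosSemidef := by
    have : (Mᴴ * M).PosSemidef := Matrix.posSemidef_conjTranspose_mul_self M
    rw [Matrix.conjTranspose_eq_transpose_of_trivial] at this
    exact this.inv
  have h2 := h1.dotProduct_mulVec_nonneg (Mᵀ.mulVec u)
  unfold projMat
  rw [← Matrix.mulVec_mulVec, ← Matrix.mulVec_mulVec, Matrix.dotProduct_mulVec,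
    ← Matrix.mulVec_transpose]
  simpa using h2

section
variable {n p : ℕ} (X : Matrix (Fin n) (Fin p) ℝ)

lemma resid_nonneg (τ : Finset (Fin p)) (h : IsUnit ((subcols X τ)ᵀ * subcols X τ).det)
    (u : Fin n → ℝ) : 0 ≤ u ⬝ᵥ (1 - proj X τ).mulVec u := by
  have e := proj_eq X τ h u
  have : u ⬝ᵥ (1 - proj X τ).mulVec u = inner ℝ (tl u) (tl ((1 - proj X τ).mulVec u)) := by
    rw [EuclideanSpace.inner_toLp_toLp, dotProduct_comm]; simp
  rw [this, e]
  have h2 : (Sp X τ)ᗮ.starProjection ((Sp X τ)ᗮ.starProjection (tl u)) = (Sp X τ)ᗮ.starProjection (tl u) :=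
    Submodule.starProjection_eq_self_iff.2 (Submodule.starProjection_apply_mem _ _)
  rw [← h2, ← Submodule.inner_starProjection_left_eq_right]
  exact real_inner_self_nonneg

lemma fstat_nonneg (τ Λ : Finset (Fin p)) (hτ : τ.card ≤ n)
    (h : IsUnit ((subcols X τ)ᵀ * subcols X τ).det) (u : Fin n → ℝ) : 0 ≤ fstat X τ Λ u := by
  unfold fstat
  have : (τ.card : ℝ) ≤ n := by exact_mod_cast hτ
  exact div_nonneg (projMat_nonneg _ u) (div_nonneg (resid_nonneg X τ h u) (by linarith))

lemma fstat_meas (τ Λ : Finset (Fin p)) : Measurable (fstat X τ Λ) := by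
  unfold fstat
  have key : ∀ A : Matrix (Fin n) (Fin n) ℝ, Measurable (fun u : Fin n → ℝ => u ⬝ᵥ A.mulVec u) := by
    intro A
    apply Continuous.measurable
    exact continuous_id.dotProduct (continuous_const.matrix_mulVec continuous_id)
  exact (key _).div ((key _).div_const _)

lemma qant_spec (τ Λ : Finset (Fin p)) (hτ : τ.card ≤ n)
    (h : IsUnit ((subcols X τ)ᵀ * subcols X τ).det) (α : ℝ) (hα : α ∈ Set.Ioo (0:ℝ) 1) :
    0 ≤ qant X τ Λ α ∧ ENNReal.ofReal α ≤ stdGaussian n {u | fstat X τ Λ u ≤ qant X τ Λ α} := by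
  have hms := fstat_meas X τ Λ
  set ν := (stdGaussian n).map (fstat X τ Λ) with hν
  have : IsProbabilityMeasure ν := Measure.isProbabilityMeasure_map hms.aemeasurable
  have hS : {x : ℝ | α ≤ (ν (Set.Iic x)).toReal} = {x : ℝ | α ≤ cdf ν x} := by
    ext x; simp only [Set.mem_ofPred_eq]; rw [cdf_eq_real]; rfl
  have hq : qant X τ Λ α = sInf {x : ℝ | α ≤ cdf ν x} := by rw [← hS]; rfl
  have hpos : ∀ x ∈ {x : ℝ | α ≤ cdf ν x}, 0 ≤ x := by
    intro x hx
    by_contra hneg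
    push Not at hneg
    have : ν (Set.Iic x) = 0 := by
      rw [hν, Measure.map_apply hms measurableSet_Iic]
      convert measure_empty (μ := stdGaussian n)
      ext u
      simp only [Set.mem_preimage, Set.mem_Iic, Set.mem_empty_iff_false, iff_false, not_le]
      exact lt_of_lt_of_le hneg (fstat_nonneg X τ Λ hτ h u)
    simp only [Set.mem_ofPred_eq, cdf_eq_real, Measure.real, this] at hx
    simp at hx
    linarith [hα.1]
  have hne : {x : ℝ | α ≤ cdf ν x}.Nonempty := by
    obtain ⟨x, hx⟩ := ((tendsto_cdf_atTop ν).eventually (lt_mem_nhds hα.2)).exists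
    exact ⟨x, hx.le⟩
  have hbdd : BddBelow {x : ℝ | α ≤ cdf ν x} := ⟨0, hpos⟩
  refine ⟨by rw [hq]; exact Real.sInf_nonneg hpos, ?_⟩
  have key : α ≤ cdf ν (qant X τ Λ α) := by
    have hrc := (cdf ν).right_continuous (qant X τ Λ α)
    have hrc2 : Tendsto (cdf ν) (nhdsWithin (qant X τ Λ α) (Set.Ioi (qant X τ Λ α)))
        (nhds (cdf ν (qant X τ Λ α))) := hrc.mono_left (nhdsWithin_mono _ Set.Ioi_subset_Ici_self)
    refine ge_of_tendsto hrc2 ?_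
    filter_upwards [self_mem_nhdsWithin] with y hy
    rw [hq, Set.mem_Ioi, csInf_lt_iff hbdd hne] at hy
    obtain ⟨s, hs, hsy⟩ := hy
    exact le_trans hs ((cdf ν).mono hsy.le)
  have e : stdGaussian n {u | fstat X τ Λ u ≤ qant X τ Λ α} = ν (Set.Iic (qant X τ Λ α)) := by
    rw [hν, Measure.map_apply hms measurableSet_Iic]; rfl
  rw [e]
  rw [cdf_eq_real] at key
  exact (ENNReal.ofReal_le_iff_le_toReal (measure_ne_top _ _)).2 key

lemma resid_kill (τ τ' : Finset (Fin p)) (hsub : τ ⊆ τ') (h : IsUnit ((subcols X τ')ᵀ * subcols X τ').det)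
    (β : Fin p → ℝ) : (1 - proj X τ').mulVec (X.mulVec (maskOn τ β)) = 0 := by
  have e := proj_eq X τ' h (X.mulVec (maskOn τ β))
  rw [Q_zero _ _ (Sp_mono X hsub (mask_mem X τ β))] at e
  have := congrArg (WithLp.ofLp) e
  simpa using this

lemma T_ok (τ₀ Λ : Finset (Fin p)) (β₀ : Fin p → ℝ) (hβ : ∀ j ∉ τ₀, β₀ j = 0) (σ : ℝ) (hσ : 0 < σ)
    (hk : τ₀.card ≤ n)
    (hGram : ∀ τ : Finset (Fin p), τ.card ≤ n → IsUnit ((subcols X τ)ᵀ * subcols X τ).det)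
    (q : ℝ) (hq : 0 ≤ q) (u : Fin n → ℝ) (hu : fstat X τ₀ Λ u ≤ q) :
    0 ≤ Tnuc X Λ τ₀ β₀ (X.mulVec β₀ + σ • u) ∧ Tnuc X Λ τ₀ β₀ (X.mulVec β₀ + σ • u) ≤ (q : EReal) := by
  unfold Tnuc
  rw [if_neg (by
    rintro ⟨i, hi, hne⟩
    exact hne (hβ i (Finset.mem_sdiff.1 hi).2))]
  split_ifs with h0
  · exact ⟨le_rfl, by exact_mod_cast hq⟩
  set r := X.mulVec (maskOn (τ₀ \ Λ) β₀) with hr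
  have hv : X.mulVec β₀ + σ • u - X.mulVec (maskOn Λ β₀) = r + σ • u := by
    have : β₀ = maskOn (τ₀ \ Λ) β₀ + maskOn Λ β₀ := by
      ext j
      simp only [maskOn, Pi.add_apply, Finset.mem_sdiff]
      by_cases h1 : j ∈ τ₀ <;> by_cases h2 : j ∈ Λ <;> simp [h1, h2, hβ]
    have e : X.mulVec β₀ = r + X.mulVec (maskOn Λ β₀) := by
      conv_lhs => rw [this]
      rw [Matrix.mulVec_add]
    rw [e]; abel
  rw [hv]
  have hk1 : (1 - proj X τ₀).mulVec r = 0 := resid_kill X _ _ Finset.sdiff_subset (hGram _ hk) _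
  have hk2 : (projO X τ₀ Λ).mulVec r = 0 := by
    have hz : (1 - proj X (τ₀ \ Λ)).mulVec r = 0 :=
      resid_kill X _ _ subset_rfl (hGram _ ((Finset.card_le_card Finset.sdiff_subset).trans hk)) _
    unfold projO projMat
    rw [← Matrix.mulVec_mulVec, Matrix.transpose_mul, Matrix.transpose_sub, Matrix.transpose_one]
    rw [show (proj X (τ₀ \ Λ))ᵀ = proj X (τ₀ \ Λ) from proj_symm _, ← Matrix.mulVec_mulVec,
      ← Matrix.mulVec_mulVec r, hz]
    simp
  have hs1 : (1 - proj X τ₀)ᵀ = 1 - proj X τ₀ := by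
    rw [Matrix.transpose_sub, Matrix.transpose_one, show (proj X τ₀)ᵀ = proj X τ₀ from proj_symm _]
  have hs2 : (projO X τ₀ Λ)ᵀ = projO X τ₀ Λ := proj_symm _
  rw [quad_shift _ hs1 r u σ hk1, quad_shift _ hs2 r u σ hk2]
  have e : σ ^ 2 * (u ⬝ᵥ (projO X τ₀ Λ).mulVec u) /
      (σ ^ 2 * (u ⬝ᵥ (1 - proj X τ₀).mulVec u) / ((n:ℝ) - τ₀.card)) = fstat X τ₀ Λ u := by
    unfold fstat
    rw [mul_div_assoc (σ^2) (u ⬝ᵥ (1 - proj X τ₀).mulVec u), mul_div_mul_left _ _ (by positivity)]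
  rw [e]
  exact ⟨by exact_mod_cast fstat_nonneg X τ₀ Λ hk (hGram _ hk) u, by exact_mod_cast hu⟩
end

end

/-- **Theorem 3.2.** Large-sample (finite-`d`) validity of the repro-samples
confidence set `Γ^{β_Λ}_α` for the subvector `β_{0,Λ}` of regression coefficients. -/
theorem coefficient_confidence_set_large_sample {n p : ℕ}
    (X : Matrix (Fin n) (Fin p) ℝ) (τ₀ : Finset (Fin p)) (β₀ : Fin p → ℝ)
    (hβsupp : ∀ j ∉ τ₀, β₀ j = 0) (hβne : ∀ j ∈ τ₀, β₀ j ≠ 0)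
    (σ₀ : ℝ) (hσ₀ : 0 < σ₀)
    (hGram : ∀ τ : Finset (Fin p), τ.card ≤ n →
      IsUnit ((subcols X τ)ᵀ * subcols X τ).det)
    (hid : Identifiable X τ₀ β₀)
    (t : ℝ) (ht : 0 < t) (lam : ℝ)
    (hlam : lam / (n : ℝ) ∈ Set.Icc
      (6 * σ₀ ^ 2 * ((τ₀.card : ℝ) + 1) * Real.log ((p : ℝ)/2) / (n : ℝ) + t)
      (0.05 * Cmin X τ₀ β₀))
    (hsize : (τ₀.card : ℝ) * Real.log (p : ℝ) / (n : ℝ) < 0.23)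
    (hCmin : Cmin X τ₀ β₀ >
      120 * (((τ₀.card : ℝ) + 2) * Real.log ((p : ℝ) + 1) / (n : ℝ)) * σ₀ ^ 2)
    (Λ : Finset (Fin p))
    (α : ℝ) (hα : α ∈ Set.Ioo (0 : ℝ) 1)
    (tauHat : (Fin n → ℝ) → (Fin n → ℝ) → Finset (Fin p))
    (hmin : ∀ (y ustar : Fin n → ℝ) (τ : Finset (Fin p)),
      objPen X lam y ustar (tauHat y ustar) ≤ objPen X lam y ustar τ)
    (d : ℕ) :
    ENNReal.ofReal (α -
        (6 * Real.exp (-((n : ℝ) / (18 * σ₀ ^ 2)) *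
            (0.3 * Cmin X τ₀ β₀ - 36 * (Real.log ((p : ℝ) + 1) / (n : ℝ)) * σ₀ ^ 2)) +
          3 * Real.exp (-((n : ℝ) * t) / (3 * σ₀ ^ 2)) +
          Real.exp (-((n : ℝ) * (d : ℝ)) *
            (0.23 - ((τ₀.card : ℝ) * Real.log (p : ℝ) + 2) / (n : ℝ))))) ≤
      jointMeasure n d
        {ω | ∃ τ : Finset (Fin p),
          (∃ b : Fin d, tauHat (X.mulVec β₀ + σ₀ • ω.1) (ω.2 b) = τ) ∧
          0 ≤ Tnuc X Λ τ β₀ (X.mulVec β₀ + σ₀ • ω.1) ∧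
          Tnuc X Λ τ β₀ (X.mulVec β₀ + σ₀ • ω.1) ≤ ((qant X τ Λ α : ℝ) : EReal)} := by
  obtain ⟨hl1, hl2⟩ := hlam
  have hn0 : 0 < n := by
    rcases Nat.eq_zero_or_pos n with h | h
    · subst h; simp at hl1; linarith
    · exact h
  have hn0' : (0:ℝ) < n := by exact_mod_cast hn0
  set k := τ₀.card with hkdef
  set C := Cmin X τ₀ β₀ with hCdef
  have hlogp1 : 0 ≤ Real.log ((p:ℝ) + 1) := Real.log_nonneg (by linarith [Nat.cast_nonneg (α := ℝ) p])
  have hlogp : 0 ≤ Real.log (p:ℝ) := Real.log_natCast_nonneg p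
  have hC : 0 < C := lt_of_le_of_lt (by positivity) hCmin
  have hk : 1 ≤ k := by
    by_contra hcon
    have h0 : τ₀.card = 0 := by omega
    have h1 : {τ : Finset (Fin p) | τ ≠ τ₀ ∧ τ.card ≤ τ₀.card} = ∅ := by
      ext τ
      simp only [Set.mem_ofPred_eq, Set.mem_empty_iff_false, iff_false, not_and, h0]
      intro h2 h3
      rw [Finset.card_eq_zero] at h0
      have : τ = ∅ := Finset.card_eq_zero.1 (by omega)
      exact h2 (this.trans h0.symm)
    have : C = 0 := by rw [hCdef, Cmin, h1]; simp
    linarith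
  by_cases htriv : (n:ℝ) * d * (0.23 - ((k:ℝ) * Real.log p + 2) / n) ≤ 0
  · have h1 : 1 ≤ Real.exp (-((n:ℝ) * d) * (0.23 - ((k:ℝ) * Real.log p + 2) / n)) :=
      Real.one_le_exp (by linarith)
    rw [ENNReal.ofReal_of_nonpos]
    · exact zero_le
    · have a1 := Real.exp_pos (-((n : ℝ) / (18 * σ₀ ^ 2)) *
            (0.3 * C - 36 * (Real.log ((p : ℝ) + 1) / (n : ℝ)) * σ₀ ^ 2))
      have a2 := Real.exp_pos (-((n : ℝ) * t) / (3 * σ₀ ^ 2))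
      linarith [hα.2]
  push Not at htriv
  have hd : 1 ≤ d := by
    by_contra h
    have : d = 0 := by omega
    subst this; simp at htriv
  have hd' : (0:ℝ) < d := by exact_mod_cast hd
  have hmain : (k:ℝ) * Real.log p + 2 < 0.23 * n := by
    have h1 : 0 < 0.23 - ((k:ℝ) * Real.log p + 2) / n := by
      by_contra h
      push Not at h
      have := mul_nonpos_of_nonneg_of_nonpos (by positivity : 0 ≤ (n:ℝ) * d) h
      linarith
    have h2 : ((k:ℝ) * Real.log p + 2) / n < 0.23 := by linarith
    rwa [div_lt_iff₀ hn0'] at h2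
  have hklog : 0 ≤ (k:ℝ) * Real.log p := by positivity
  have hn9 : 9 ≤ n := by
    by_contra h
    have : (n:ℝ) ≤ 8 := by exact_mod_cast (by omega : n ≤ 8)
    linarith
  have hkp : k ≤ p := by simpa using τ₀.card_le_univ
  have hkn : k < n := by
    rcases lt_or_ge p 2 with h | h
    · omega
    · have h2 : Real.log 2 ≤ Real.log p := Real.log_le_log (by norm_num) (by exact_mod_cast h)
      have h3 := Real.log_two_gt_d9
      have h4 : (k:ℝ) * 0.69 ≤ k * Real.log p := mul_le_mul_of_nonneg_left (by linarith) (by positivity)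
      have : (k:ℝ) < n := by linarith
      exact_mod_cast this
  have hp : 1 ≤ p := hk.trans hkp
  have hp' : (1:ℝ) ≤ p := by exact_mod_cast hp
  have hm : tl (X.mulVec β₀) ∈ Sp X τ₀ := mean_mem X τ₀ β₀ hβsupp
  have hsep : ∀ τ : Finset (Fin p), τ ≠ τ₀ → τ.card ≤ τ₀.card →
      C * (n * (τ₀ \ τ).card) ≤ ‖(Sp X τ)ᗮ.starProjection (tl (X.mulVec β₀))‖^2 := by
    intro τ h1 h2
    have hle : C ≤ sqnorm ((1 - proj X τ).mulVec (X.mulVec β₀)) /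
        ((n * max (τ₀ \ τ).card 1 : ℕ) : ℝ) := by
      refine csInf_le ⟨0, ?_⟩ ⟨τ, ⟨h1, h2⟩, rfl⟩
      rintro _ ⟨τ', -, rfl⟩
      refine div_nonneg ?_ (Nat.cast_nonneg _)
      rw [sqnorm_eq]; positivity
    have hl : 1 ≤ (τ₀ \ τ).card := by
      rw [Nat.one_le_iff_ne_zero, ← Nat.pos_iff_ne_zero, Finset.card_pos, Finset.sdiff_nonempty]
      intro h
      exact h1 (Finset.eq_of_subset_of_card_le h h2).symm
    rw [max_eq_left hl, sqnorm_eq, proj_eq X τ (hGram τ (by omega))] at hle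
    have hl' : (0:ℝ) < ((n * (τ₀ \ τ).card : ℕ) : ℝ) := by
      exact_mod_cast Nat.mul_pos hn0 hl
    rw [le_div_iff₀ hl'] at hle
    push_cast at hle
    exact hle
  have hlam1 : 6 * σ₀ ^ 2 * ((k:ℝ) + 1) * Real.log ((p:ℝ) / 2) + n * t ≤ lam := by
    rw [le_div_iff₀ hn0', add_mul, div_mul_cancel₀ _ hn0'.ne'] at hl1
    linarith
  have hlam2 : lam ≤ 0.05 * (n * C) := by
    rw [div_le_iff₀ hn0'] at hl2
    linarith
  have hp1 : (0:ℝ) < (p:ℝ) + 1 := by positivity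
  have hNbig : 6 * Real.log ((p:ℝ) + 1) ≤ n * C / σ₀^2 / 60 := by
    have h1 : 120 * (((k:ℝ) + 2) * Real.log ((p:ℝ) + 1)) * σ₀^2 ≤ n * C := by
      have := mul_le_mul_of_nonneg_left hCmin.lt.le hn0'.le
      calc _ = (n:ℝ) * (120 * (((k:ℝ) + 2) * Real.log ((p:ℝ) + 1) / n) * σ₀^2) := by field_simp
        _ ≤ _ := this
    have h2 : 3 * Real.log ((p:ℝ) + 1) ≤ ((k:ℝ) + 2) * Real.log ((p:ℝ) + 1) := by
      have : (1:ℝ) ≤ k := by exact_mod_cast hk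
      nlinarith
    rw [div_div, le_div_iff₀ (by positivity)]
    have := mul_le_mul_of_nonneg_right h2 (by positivity : 0 ≤ 120 * σ₀^2)
    linarith
  have hy : Real.exp (-(n * C / σ₀^2 / 60)) * ((p:ℝ) + 1) ^ 6 ≤ 1 := by
    have h1 : ((p:ℝ) + 1) ^ 6 = Real.exp (6 * Real.log ((p:ℝ) + 1)) := by
      have h := Real.exp_nat_mul (Real.log ((p:ℝ) + 1)) 6
      rw [Real.exp_log hp1] at h
      rw [← h]; norm_num
    rw [h1, ← Real.exp_add, Real.exp_le_one_iff]
    linarith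
  have hfail := fail_prob X τ₀ hk hkn hn9 (X.mulVec β₀) hm σ₀ lam C t hσ₀ hC ht hsep hlam1 hlam2 hy d hd
  obtain ⟨hq0, hqa⟩ := qant_spec X τ₀ Λ hkn.le (hGram _ hkn.le) α hα
  have e1 : ((p:ℝ)+1)^2 * Real.exp (-(n * C / σ₀^2 / 60)) = Real.exp (-((n : ℝ) / (18 * σ₀ ^ 2)) *
            (0.3 * C - 36 * (Real.log ((p : ℝ) + 1) / (n : ℝ)) * σ₀ ^ 2)) := by
    have h1 : ((p:ℝ) + 1) ^ 2 = Real.exp (2 * Real.log ((p:ℝ) + 1)) := by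
      have h := Real.exp_nat_mul (Real.log ((p:ℝ) + 1)) 2
      rw [Real.exp_log hp1] at h
      rw [← h]; norm_num
    rw [h1, ← Real.exp_add]
    congr 1
    field_simp
    ring
  have e2 : Real.exp (-(n * t / (3 * σ₀^2))) = Real.exp (-((n : ℝ) * t) / (3 * σ₀ ^ 2)) := by
    congr 1; ring
  have e3 : (Real.exp 2 * (p:ℝ) ^ k * Real.exp (-(0.23 * n))) ^ d =
      Real.exp (-((n : ℝ) * (d : ℝ)) * (0.23 - ((k : ℝ) * Real.log (p : ℝ) + 2) / (n : ℝ))) := by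
    have h1 : (p:ℝ) ^ k = Real.exp (k * Real.log p) := by
      rw [Real.exp_nat_mul, Real.exp_log (by linarith)]
    rw [h1, ← Real.exp_add, ← Real.exp_add, ← Real.exp_nat_mul]
    congr 1
    field_simp
    ring
  rw [← hkdef, e1, e2, e3] at hfail
  rw [ENNReal.ofReal_sub _ (by positivity), tsub_le_iff_right]
  refine le_trans ?_ (add_le_add_right hfail _)
  refine le_trans ?_ (measure_union_le _ _)
  calc ENNReal.ofReal α ≤ stdGaussian n {u | fstat X τ₀ Λ u ≤ qant X τ₀ Λ α} := hqa
    _ = jointMeasure n d ({u | fstat X τ₀ Λ u ≤ qant X τ₀ Λ α} ×ˢ Set.univ) := by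
        rw [jointMeasure, Measure.prod_prod, measure_univ, mul_one]
    _ ≤ _ := by
        apply measure_mono
        rintro ⟨u, v⟩ ⟨hu, -⟩
        simp only [Set.mem_ofPred_eq] at hu
        by_cases hb : ∃ b : Fin d, tauHat (X.mulVec β₀ + σ₀ • u) (v b) = τ₀
        · left
          exact ⟨τ₀, hb, T_ok X τ₀ Λ β₀ hβsupp σ₀ hσ₀ hkn.le hGram _ hq0 u hu⟩
        · right
          push Not at hb
          intro b
          exact ⟨_, hb b, hmin _ _ _⟩

end ReproSamples
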